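/- arXiv:2602.12208 — 4 statements merged into one kernel-verified Lean document; each statement's English description precedes it below -/
import Mathlib

section
/- Write lambda_l for lambda_l(r,s). (i) If r+s > p^{n+1} and 1 <= l <= r+s-p^{n+1}, then lambda_l = p^{n+1}. (ii) Suppose max(r+s-p^{n+1},0)+1 <= l <= min(r,s) and write l = t p^n + k with integers t >= 0 and 1 <= k <= p^n. If m = 0, then lambda_l = (r_n+s_n-2t)p^n when 1 <= k <= M and lambda_l = (r_n+s_n-2t-1)p^n when M+1 <= k <= p^n. If m > 0, then with (mu_1 >= ... >= mu_m) = lambda(R,S): lambda_l = (r_n+s_n-2t+1)p^n if 1 <= k <= max(e,0); lambda_l = (r_n+s_n-2t)p^n + mu_k if max(e,0)+1 <= k <= m; lambda_l = (r_n+s_n-2t)p^n if m+1 <= k <= M; lambda_l = (r_n+s_n-2t)p^n - mu_{m+M+1-k} if M+1 <= k <= p^n - max(-e,0); and lambda_l = (r_n+s_n-2t-1)p^n if p^n - max(-e,0)+1 <= k <= p^n. -/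
open scoped BigOperators

noncomputable section

/-- The basis vector `v_{a,b}` of `M(r,s)` (1-indexed), read as `0` when
`a` or `b` is out of range. -/
def vv (F : Type*) [Field F] (r s : ℕ) (a b : ℤ) : Matrix (Fin r) (Fin s) F :=
  Matrix.of fun i j => if (i : ℤ) + 1 = a ∧ (j : ℤ) + 1 = b then 1 else 0

/-- The linear endomorphism `T` of `M(r,s)` with `T(v_{i,j}) = v_{i-1,j} + v_{i,j-1}`
(out-of-range symbols read as `0`); it models the action of `g - 1`. -/
def TT (F : Type*) [Field F] (r s : ℕ) :
    Matrix (Fin r) (Fin s) F →ₗ[F] Matrix (Fin r) (Fin s) F where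
  toFun A := Matrix.of fun i j =>
    (if h : (i : ℕ) + 1 < r then A ⟨(i : ℕ) + 1, h⟩ j else 0) +
    (if h : (j : ℕ) + 1 < s then A i ⟨(j : ℕ) + 1, h⟩ else 0)
  map_add' A B := by
    ext i j
    simp only [Matrix.of_apply, Matrix.add_apply]
    split_ifs <;> abel
  map_smul' c A := by
    ext i j
    simp only [Matrix.of_apply, Matrix.smul_apply, RingHom.id_apply, smul_eq_mul]
    split_ifs <;> ring

/-- `x_m = ∑_{j=1}^m (-1)^{j-1} v_{j, m+1-j}` (the empty sum if `m ≤ 0`). -/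
def xx (F : Type*) [Field F] (r s : ℕ) (m : ℤ) : Matrix (Fin r) (Fin s) F :=
  ∑ j ∈ Finset.range m.toNat, ((-1 : F) ^ j) • vv F r s ((j : ℤ) + 1) (m - j)

/-- The subspace `D_d` of `M(r,s)`, spanned by the `v_{i,j}` with `i + j = d + 1`. -/
def Dd (F : Type*) [Field F] (r s : ℕ) (d : ℕ) :
    Submodule F (Matrix (Fin r) (Fin s) F) :=
  Submodule.span F { A | ∃ a b : ℕ, 1 ≤ a ∧ a ≤ r ∧ 1 ≤ b ∧ b ≤ s ∧
    a + b = d + 1 ∧ A = vv F r s (a : ℤ) (b : ℤ) }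

/-- Binomial coefficient `C(a,b)` as an element of `F`, with the convention that
it is `0` when `b < 0` or `b > a`. -/
def binF (F : Type*) [Field F] (a b : ℤ) : F :=
  if 0 ≤ b ∧ b ≤ a then (Nat.choose a.toNat b.toNat : F) else 0

/-- `lam` (restricted to indices `1,…,min r s`) is the Jordan type of the nilpotent
operator `T` on `M(r,s)`: a nonincreasing list of `min r s` positive integers such that
for each `m ≥ 1` the number of parts `≥ m` is `rank T^{m-1} - rank T^m`. -/
def IsJordanType (F : Type*) [Field F] (r s : ℕ) (lam : ℕ → ℕ) : Prop :=
  (∀ l, 1 ≤ l → l ≤ min r s → 0 < lam l) ∧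
  (∀ l l', 1 ≤ l → l ≤ l' → l' ≤ min r s → lam l' ≤ lam l) ∧
  ∀ m, 1 ≤ m →
    ((Finset.Icc 1 (min r s)).filter fun l => m ≤ lam l).card =
      Module.finrank F ↥(LinearMap.range ((TT F r s) ^ (m - 1))) -
      Module.finrank F ↥(LinearMap.range ((TT F r s) ^ m))

open Polynomial

/-- `f` has degree at most `n`, where `n` is an integer; for negative `n` this means `f = 0`. -/
def DegLE {F : Type*} [Field F] (n : ℤ) (f : F[X]) : Prop := ∀ i : ℕ, n < i → f.coeff i = 0

section DegLE

variable {F : Type*} [Field F] {m n : ℤ} {f g : F[X]}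

lemma degLE_iff : DegLE n f ↔ f = 0 ∨ (f.natDegree : ℤ) ≤ n := by
  constructor
  · intro h
    by_contra! hc
    exact hc.1 (leadingCoeff_eq_zero.mp (h _ hc.2))
  · rintro (rfl | h) i hi
    · simp
    · exact coeff_eq_zero_of_natDegree_lt (by omega)

lemma DegLE.natDegree_le (h : DegLE n f) (hf : f ≠ 0) : (f.natDegree : ℤ) ≤ n :=
  (degLE_iff.mp h).resolve_left hf

lemma DegLE.eq_zero (h : DegLE n f) (hn : n < 0) : f = 0 := by
  rcases degLE_iff.mp h with h | h
  · exact h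
  · omega

lemma DegLE.mono (h : DegLE n f) (hn : n ≤ m) : DegLE m f := fun i hi => h i (by omega)

lemma DegLE.zero : DegLE n (0 : F[X]) := fun _ _ => by simp

lemma DegLE.add (hf : DegLE n f) (hg : DegLE n g) : DegLE n (f + g) := fun i hi => by
  simp [hf i hi, hg i hi]

lemma DegLE.neg (hf : DegLE n f) : DegLE n (-f) := fun i hi => by simp [hf i hi]

lemma DegLE.sub (hf : DegLE n f) (hg : DegLE n g) : DegLE n (f - g) := fun i hi => by
  simp [hf i hi, hg i hi]

lemma DegLE.mul (hf : DegLE m f) (hg : DegLE n g) : DegLE (m + n) (f * g) := by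
  rcases degLE_iff.mp hf with rfl | hf
  · simpa using DegLE.zero
  rcases degLE_iff.mp hg with rfl | hg
  · simpa using DegLE.zero
  refine degLE_iff.mpr (Or.inr ?_)
  have := natDegree_mul_le (p := f) (q := g)
  omega

lemma DegLE.of_natDegree_le {k : ℕ} (h : f.natDegree ≤ k) : DegLE (k : ℤ) f :=
  degLE_iff.mpr (Or.inr (by exact_mod_cast h))

lemma DegLE.C (c : F) : DegLE 0 (C c) := DegLE.of_natDegree_le (k := 0) (by simp)

lemma DegLE.one : DegLE 0 (1 : F[X]) := DegLE.of_natDegree_le (k := 0) (by simp)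

lemma DegLE.X_pow (k : ℕ) : DegLE (k : ℤ) (X ^ k : F[X]) := DegLE.of_natDegree_le (by simp)

lemma DegLE.C_mul (c : F) (hf : DegLE n f) : DegLE n (Polynomial.C c * f) := by
  simpa using (DegLE.C c).mul hf

lemma DegLE.pow (hf : DegLE n f) (k : ℕ) : DegLE (k * n) (f ^ k) := by
  induction k with
  | zero => simpa using DegLE.one
  | succ k ih => rw [pow_succ]; exact (ih.mul hf).mono (by push_cast; linarith)

lemma natDegree_X_add_one_pow (k : ℕ) : ((X + 1 : F[X]) ^ k).natDegree = k := by
  rw [← C_1, natDegree_pow, natDegree_X_add_C, mul_one]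

lemma X_add_one_ne_zero : (X + 1 : F[X]) ≠ 0 := by
  rw [← C_1]; exact X_add_C_ne_zero _

lemma DegLE.X_add_one_pow (k : ℕ) : DegLE (k : ℤ) ((X + 1 : F[X]) ^ k) :=
  DegLE.of_natDegree_le (natDegree_X_add_one_pow k).le

lemma DegLE.of_mul (h : DegLE n (f * g)) (hf : f ≠ 0) : DegLE (n - f.natDegree) g := by
  by_cases hg : g = 0
  · subst hg; exact DegLE.zero
  have := h.natDegree_le (mul_ne_zero hf hg)
  rw [natDegree_mul hf hg] at this
  exact degLE_iff.mpr (Or.inr (by push_cast at this; omega))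

lemma DegLE.of_X_pow_mul {k : ℕ} (h : DegLE n (X ^ k * g)) : DegLE (n - k) g := by
  simpa using h.of_mul (pow_ne_zero k X_ne_zero)

lemma DegLE.of_X_add_one_pow_mul {k : ℕ} (h : DegLE n ((X + 1) ^ k * g)) : DegLE (n - k) g := by
  simpa only [natDegree_X_add_one_pow] using h.of_mul (pow_ne_zero k X_add_one_ne_zero)

lemma DegLE.eq_zero_of_dvd (h : DegLE n g) (hd : f ∣ g) (hn : n < f.natDegree) : g = 0 := by
  by_contra hg
  have h1 := natDegree_le_of_dvd hd hg
  have h2 := h.natDegree_le hg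
  omega

lemma isCoprime_X_X_add_one : IsCoprime (X : F[X]) (X + 1) := ⟨-1, 1, by ring⟩

lemma X_add_one_dvd_iff : (X + 1 : F[X]) ∣ f ↔ f.eval (-1) = 0 := by
  have : (X + 1 : F[X]) = X - Polynomial.C (-1) := by simp
  rw [this, dvd_iff_isRoot, IsRoot.def]

lemma X_add_one_dvd_sub_C_eval : (X + 1 : F[X]) ∣ f - Polynomial.C (f.eval (-1)) := by
  simp [X_add_one_dvd_iff]

end DegLE

/-- `(P, Q, W)` is the dehomogenization at `y = 1` of a homogeneous syzygy of degree `e` of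
`x ^ a`, `y ^ b`, `(x + y) ^ c`. -/
structure Syz {F : Type*} [Field F] (a b c : ℕ) (e : ℤ) (P Q W : F[X]) : Prop where
  rel : X ^ a * P + Q + (X + 1) ^ c * W = 0
  degP : DegLE (e - a) P
  degQ : DegLE (e - b) Q
  degW : DegLE (e - c) W

section Vanishing

variable {F : Type*} [Field F] {a b c : ℕ} {e : ℤ} {P Q W : F[X]}

lemma pow_pred_dvd_wronskian {u f g : F[X]} {k : ℕ} (h : u ^ k ∣ f) :
    u ^ (k - 1) ∣ wronskian f g := by
  obtain ⟨v, rfl⟩ := h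
  refine dvd_sub (Dvd.dvd.mul_right ((pow_dvd_pow u (by omega)).mul_right v) _) ?_
  rw [derivative_mul, derivative_pow]
  refine Dvd.dvd.mul_right (dvd_add ?_ ?_) _
  · exact ((Dvd.intro_left _ rfl).mul_right _).mul_right _
  · exact (pow_dvd_pow u (by omega)).mul_right _

lemma X_pow_dvd_of_wronskian_eq_zero (p : ℕ) [CharP F p] {f g : F[X]} (hf : f ≠ 0) (hg : g ≠ 0)
    (hfp : f.natDegree < p) (hgp : g.natDegree < p) (hw : wronskian f g = 0)
    {k : ℕ} (h : X ^ k ∣ f) : X ^ k ∣ g := by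
  obtain ⟨f₀, hf₀, hf₀'⟩ := exists_eq_pow_rootMultiplicity_mul_and_not_dvd f hf 0
  obtain ⟨g₀, hg₀, hg₀'⟩ := exists_eq_pow_rootMultiplicity_mul_and_not_dvd g hg 0
  have hk : k ≤ f.rootMultiplicity 0 := by
    rw [le_rootMultiplicity_iff hf]; simpa using h
  set v := f.rootMultiplicity 0
  set w := g.rootMultiplicity 0
  simp only [C_0, sub_zero] at hf₀ hg₀ hf₀' hg₀'
  have hv : v ≤ f.natDegree := by
    have := natDegree_le_of_dvd (Dvd.intro _ hf₀.symm) hf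
    simpa using this
  have hw' : w ≤ g.natDegree := by
    have := natDegree_le_of_dvd (Dvd.intro _ hg₀.symm) hg
    simpa using this
  have key : X ^ (v + w) * (C ((w : F) - v) * (f₀ * g₀) +
      X * (f₀ * derivative g₀ - derivative f₀ * g₀)) = 0 := by
    have h1 : X * wronskian f g = 0 := by rw [hw, mul_zero]
    have hX : ∀ n : ℕ, (X : F[X]) * derivative (X ^ n) = C (n : F) * X ^ n := by
      intro n
      rcases n with _ | n
      · simp
      · rw [derivative_X_pow, Nat.add_sub_cancel, pow_succ]; ring
    rw [wronskian, hf₀, hg₀, derivative_mul, derivative_mul] at h1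
    rw [C_sub, pow_add]
    linear_combination h1 - X ^ v * f₀ * g₀ * hX w + X ^ w * f₀ * g₀ * hX v
  have h2 := (mul_eq_zero.mp key).resolve_left (pow_ne_zero _ X_ne_zero)
  have h3 : (X : F[X]) ∣ C ((w : F) - v) * (f₀ * g₀) :=
    ⟨-(f₀ * derivative g₀ - derivative f₀ * g₀), by linear_combination h2⟩
  have h4 : (w : F) = v := by
    by_contra hne
    rcases prime_X.dvd_or_dvd h3 with h | h
    · rw [X_dvd_iff, coeff_C_zero] at h
      exact hne (sub_eq_zero.mp h)
    · rcases prime_X.dvd_or_dvd h with h | h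
      · exact hf₀' h
      · exact hg₀' h
  have h5 : w = v := by
    have := (CharP.natCast_eq_natCast F p).mp h4
    exact Nat.ModEq.eq_of_lt_of_lt this (by omega) (by omega)
  rw [hg₀, h5]
  exact (pow_dvd_pow X hk).mul_right _

/-- In characteristic `p` there is no syzygy of degree `e < p` below half the total degree. -/
theorem Syz.eq_zero (p : ℕ) [CharP F p] (h : Syz a b c e P Q W)
    (hsum : 2 * e + 2 ≤ a + b + c) (hab : e < a + b) (hac : e < a + c) (hbc : e < b + c)
    (hep : e < p) : P = 0 ∧ Q = 0 ∧ W = 0 := by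
  have hcop : ∀ k l : ℕ, IsCoprime (X ^ k : F[X]) ((X + 1) ^ l) := fun k l =>
    isCoprime_X_X_add_one.pow
  have hQ : Q = 0 → P = 0 ∧ Q = 0 ∧ W = 0 := by
    rintro rfl
    have hd : (X + 1) ^ c ∣ X ^ a * P := ⟨-W, by linear_combination h.rel⟩
    have hP : P = 0 := h.degP.eq_zero_of_dvd ((hcop a c).symm.dvd_of_dvd_mul_left hd)
      (by rw [natDegree_X_add_one_pow]; omega)
    subst hP
    have := h.rel
    simpa [X_add_one_ne_zero] using this
  have hP : P = 0 → P = 0 ∧ Q = 0 ∧ W = 0 := by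
    rintro rfl
    refine hQ (h.degQ.eq_zero_of_dvd (f := (X + 1) ^ c) ⟨-W, by linear_combination h.rel⟩ ?_)
    rw [natDegree_X_add_one_pow]; omega
  by_cases ha : a = 0
  · exact hQ (h.degQ.eq_zero (by omega))
  by_cases hc : c = 0
  · exact hP (h.degP.eq_zero (by omega))
  by_cases hP0 : P = 0
  · exact hP hP0
  by_cases hQ0 : Q = 0
  · exact hQ hQ0
  exfalso
  set f := X ^ a * P with hf
  have hf0 : f ≠ 0 := mul_ne_zero (pow_ne_zero _ X_ne_zero) hP0
  have hfd : DegLE e f := ((DegLE.X_pow a).mul h.degP).mono (by omega)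
  have hfn := hfd.natDegree_le hf0
  have hQn := h.degQ.natDegree_le hQ0
  have hw : wronskian f Q = 0 := by
    by_contra hw
    have h1 : X ^ (a - 1) ∣ wronskian f Q := pow_pred_dvd_wronskian (Dvd.intro _ rfl)
    have h2 : (X + 1) ^ (c - 1) ∣ wronskian f Q := by
      have : wronskian f Q = -wronskian ((X + 1) ^ c * W) Q := by
        have hf' : f = -Q - (X + 1) ^ c * W := by linear_combination h.rel
        rw [hf']; simp only [wronskian, derivative_sub, derivative_neg]; ring
      rw [this, dvd_neg]
      exact pow_pred_dvd_wronskian (Dvd.intro _ rfl)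
    have h3 := natDegree_le_of_dvd ((hcop (a - 1) (c - 1)).mul_dvd h1 h2) hw
    rw [natDegree_mul (pow_ne_zero _ X_ne_zero) (pow_ne_zero _ X_add_one_ne_zero),
      natDegree_X_add_one_pow, natDegree_X_pow] at h3
    have h4 := natDegree_wronskian_lt_add hw
    omega
  have hd := X_pow_dvd_of_wronskian_eq_zero p hf0 hQ0 (by omega) (by omega) hw
    (k := a) (Dvd.intro _ rfl)
  exact hQ0 (h.degQ.eq_zero_of_dvd hd (by rw [natDegree_X_pow]; omega))

end Vanishing

section Existence

variable {F : Type*} [Field F]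

lemma DegLE.of_mem_degreeLT {n : ℕ} {f : F[X]} (h : f ∈ degreeLT F n) :
    DegLE ((n : ℤ) - 1) f := by
  intro i hi
  rw [mem_degreeLT, degree_lt_iff_coeff_zero] at h
  exact h i (by omega)

lemma DegLE.mem_degreeLT {n : ℕ} {m : ℤ} {f : F[X]} (h : DegLE m f) (hm : m < n) :
    f ∈ degreeLT F n := by
  rw [Polynomial.mem_degreeLT, degree_lt_iff_coeff_zero]
  intro i hi
  exact h i (by omega)

lemma finrank_degreeLT (n : ℕ) : Module.finrank F (degreeLT F n) = n := by
  rw [(degreeLTEquiv F n).finrank_eq, Module.finrank_fin_fun]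

/-- A nonzero syzygy of degree `e` exists when the total degree is `2 * e + 1`. -/
theorem exists_syz {a b c e : ℕ} (hsum : a + b + c = 2 * e + 1) (ha : a ≤ e + 1)
    (hb : b ≤ e + 1) (hc : c ≤ e + 1) :
    ∃ P Q W : F[X], Syz a b c e P Q W ∧ ¬ (P = 0 ∧ Q = 0 ∧ W = 0) := by
  let M := degreeLT F (e + 1 - a) × degreeLT F (e + 1 - b) × degreeLT F (e + 1 - c)
  let φ : M →ₗ[F] F[X] :=
    { toFun := fun v => X ^ a * v.1.1 + v.2.1.1 + (X + 1) ^ c * v.2.2.1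
      map_add' := fun v w => by
        simp only [M, Prod.fst_add, Prod.snd_add, Submodule.coe_add]; ring
      map_smul' := fun t v => by
        simp only [M, Prod.smul_fst, Prod.smul_snd, Submodule.coe_smul, smul_add,
          mul_smul_comm, RingHom.id_apply] }
  have hφ : ∀ v : M, φ v = X ^ a * v.1.1 + v.2.1.1 + (X + 1) ^ c * v.2.2.1 := fun v => rfl
  have hmem : ∀ v : M, φ v ∈ degreeLT F (e + 1) := by
    rintro ⟨⟨P, hP⟩, ⟨Q, hQ⟩, ⟨W, hW⟩⟩
    rw [hφ]
    refine DegLE.mem_degreeLT (m := e) (((?_ : DegLE _ _).add ?_).add ?_) (by omega)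
    · exact ((DegLE.X_pow a).mul (DegLE.of_mem_degreeLT hP)).mono (by omega)
    · exact (DegLE.of_mem_degreeLT hQ).mono (by omega)
    · exact ((DegLE.X_add_one_pow c).mul (DegLE.of_mem_degreeLT hW)).mono (by omega)
  let ψ : M →ₗ[F] degreeLT F (e + 1) := φ.codRestrict _ hmem
  have hfin : ∀ n, Module.Finite F (degreeLT F n) := fun n =>
    Module.Finite.equiv (degreeLTEquiv F n).symm
  have hlt : Module.finrank F (degreeLT F (e + 1)) < Module.finrank F M := by
    simp only [M, Module.finrank_prod, finrank_degreeLT]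
    omega
  obtain ⟨⟨⟨P, hP⟩, ⟨Q, hQ⟩, ⟨W, hW⟩⟩, hv, hv0⟩ :=
    (Submodule.ne_bot_iff _).mp (LinearMap.ker_ne_bot_of_finrank_lt (f := ψ) hlt)
  refine ⟨P, Q, W, ⟨?_, ?_, ?_, ?_⟩, ?_⟩
  · have := congrArg Subtype.val (LinearMap.mem_ker.mp hv)
    simpa [ψ, hφ] using this
  · exact (DegLE.of_mem_degreeLT hP).mono (by omega)
  · exact (DegLE.of_mem_degreeLT hQ).mono (by omega)
  · exact (DegLE.of_mem_degreeLT hW).mono (by omega)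
  · rintro ⟨rfl, rfl, rfl⟩
    exact hv0 rfl

end Existence

section Basis

variable {F : Type*} [Field F]

lemma Syz.C_mul {a b c : ℕ} {e : ℤ} {P Q W : F[X]} (t : F) (h : Syz a b c e P Q W) :
    Syz a b c e (C t * P) (C t * Q) (C t * W) :=
  ⟨by linear_combination C t * h.rel, h.degP.C_mul t, h.degQ.C_mul t, h.degW.C_mul t⟩

/-- A basis `(F₁, F₂, F₃)`, `(G₁, G₂, G₃)` of the syzygies of `x ^ a`, `y ^ b`, `(x + y) ^ c`,
both of degree `d`, normalized to infinitesimal order `q` at `x = 0`, `y = 0` and `x + y = 0`. -/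
structure SyzBasis (a b c d q : ℕ) (F₁ F₂ F₃ G₁ G₂ G₃ : F[X]) : Prop where
  pos : 0 < q
  total : a + b + c = 2 * d
  hF : Syz a b c d F₁ F₂ F₃
  hG : Syz a b c d G₁ G₂ G₃
  det : ∃ κ : F, κ ≠ 0 ∧ F₁ * G₃ - F₃ * G₁ = C κ
  xF : F₁.eval 0 ≠ 0
  xG : X ^ q ∣ G₁
  yF : DegLE ((d : ℤ) - b - q) F₂
  yG : G₂.natDegree + b = d ∧ G₂ ≠ 0
  zF : (X + 1) ^ q ∣ F₃ - 1
  zG : (X + 1) ^ q ∣ G₃ - 1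
  zF₁ : (X + 1) ^ q ∣ F₁ - C (F₁.eval (-1))
  zG₁ : (X + 1) ^ q ∣ G₁ - C (G₁.eval (-1))

lemma Syz.dvd_X_add_one {a b c : ℕ} {e : ℤ} {P Q W : F[X]} (h : Syz a b c e P Q W)
    (hW : (X + 1) ∣ W) : ∃ W', W = (X + 1) * W' ∧ Syz a b (c + 1) e P Q W' := by
  obtain ⟨W', rfl⟩ := hW
  refine ⟨W', rfl, by linear_combination h.rel, h.degP, h.degQ, ?_⟩
  have := h.degW
  rw [← pow_one (X + 1)] at this
  exact this.of_X_add_one_pow_mul.mono (by push_cast; omega)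

lemma Syz.dvd_X {a b c : ℕ} {e : ℤ} {P Q W : F[X]} (h : Syz a b c e P Q W)
    (hP : X ∣ P) : ∃ P', P = X * P' ∧ Syz (a + 1) b c e P' Q W := by
  obtain ⟨P', rfl⟩ := hP
  refine ⟨P', rfl, by linear_combination h.rel, ?_, h.degQ, h.degW⟩
  have := h.degP
  rw [← pow_one X] at this
  exact this.of_X_pow_mul.mono (by push_cast; omega)

theorem exists_syzBasis (p : ℕ) [CharP F p] {a b c d : ℕ} (hsum : a + b + c = 2 * d) (ha : a ≤ d)
    (hb : b ≤ d) (hc : c ≤ d) (hdp : d < p) :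
    ∃ F₁ F₂ F₃ G₁ G₂ G₃ : F[X], SyzBasis a b c d 1 F₁ F₂ F₃ G₁ G₂ G₃ := by
  obtain ⟨F₁, F₂, F₃, hF', hF0⟩ := exists_syz (F := F) (a := a) (b := b + 1) (c := c) (e := d)
    (by omega) (by omega) (by omega) (by omega)
  obtain ⟨G₁, G₂, G₃, hG', hG0⟩ := exists_syz (F := F) (a := a + 1) (b := b) (c := c) (e := d)
    (by omega) (by omega) (by omega) (by omega)
  have hF : Syz a b c d F₁ F₂ F₃ := ⟨hF'.rel, hF'.degP, hF'.degQ.mono (by omega), hF'.degW⟩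
  have hG : Syz a b c d (X * G₁) G₂ G₃ := by
    refine ⟨by linear_combination hG'.rel, ?_, hG'.degQ, hG'.degW⟩
    have := (DegLE.X_pow (F := F) 1).mul hG'.degP
    rw [pow_one] at this
    exact this.mono (by push_cast; omega)
  have hxF : F₁.eval 0 ≠ 0 := by
    intro h
    obtain ⟨P', hP', hs⟩ := hF'.dvd_X (by rw [← sub_zero X, ← C_0, dvd_iff_isRoot]; exact h)
    have := hs.eq_zero p (by push_cast; omega) (by omega) (by omega) (by omega) (by omega)
    exact hF0 ⟨by rw [hP', this.1, mul_zero], this.2⟩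
  have hzF : F₃.eval (-1) ≠ 0 := by
    intro h
    obtain ⟨W', hW', hs⟩ := hF'.dvd_X_add_one (X_add_one_dvd_iff.mpr h)
    have := hs.eq_zero p (by push_cast; omega) (by omega) (by omega) (by omega) (by omega)
    exact hF0 ⟨this.1, this.2.1, by rw [hW', this.2.2, mul_zero]⟩
  have hzG : G₃.eval (-1) ≠ 0 := by
    intro h
    obtain ⟨W', hW', hs⟩ := hG'.dvd_X_add_one (X_add_one_dvd_iff.mpr h)
    have := hs.eq_zero p (by push_cast; omega) (by omega) (by omega) (by omega) (by omega)
    exact hG0 ⟨this.1, this.2.1, by rw [hW', this.2.2, mul_zero]⟩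
  have hyG : G₂.coeff (d - b) ≠ 0 := by
    intro h
    have hs : Syz (a + 1) (b + 1) c d G₁ G₂ G₃ := by
      refine ⟨hG'.rel, hG'.degP, fun i hi => ?_, hG'.degW⟩
      rcases eq_or_ne i (d - b) with rfl | hne
      · exact h
      · exact hG'.degQ i (by omega)
    exact hG0 (hs.eq_zero p (by push_cast; omega) (by omega) (by omega) (by omega) (by omega))
  have hG20 : G₂ ≠ 0 := by rintro rfl; simp at hyG
  have hG₂ : G₂.natDegree + b = d := by
    have h1 := hG'.degQ.natDegree_le hG20
    have h2 := le_natDegree_of_ne_zero hyG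
    omega
  have hxG : G₃.eval 0 ≠ 0 := by
    intro h
    have hX : ∀ f : F[X], f.eval 0 = 0 → X ∣ f := fun f hf => by
      rw [← sub_zero X, ← C_0, dvd_iff_isRoot]; exact hf
    have h2 : G₂.eval 0 = 0 := by
      have := congrArg (eval 0) hG.rel
      simpa [h] using this
    obtain ⟨V, rfl⟩ := hX _ h
    obtain ⟨U, rfl⟩ := hX _ h2
    have hs : Syz a b c (d - 1) G₁ U V := by
      refine ⟨?_, hG'.degP.mono (by push_cast; omega), ?_, ?_⟩
      · exact mul_left_cancel₀ X_ne_zero (by linear_combination hG.rel)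
      · have := hG'.degQ
        rw [← pow_one X] at this
        exact this.of_X_pow_mul.mono (by push_cast; omega)
      · have := hG'.degW
        rw [← pow_one X] at this
        exact this.of_X_pow_mul.mono (by push_cast; omega)
    have := hs.eq_zero p (by omega) (by omega) (by omega) (by omega) (by omega)
    exact hG0 ⟨this.1, by rw [this.2.1, mul_zero], by rw [this.2.2, mul_zero]⟩
  set G₁' := X * G₁ with hG₁'
  have hdet : ∃ κ : F, κ ≠ 0 ∧ F₁ * G₃ - F₃ * G₁' = C κ := by
    have hmin : F₁ * G₂ - F₂ * G₁' = (X + 1) ^ c * -(F₁ * G₃ - F₃ * G₁') := by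
      linear_combination F₁ * hG.rel - G₁' * hF.rel
    have hdeg : DegLE 0 (-(F₁ * G₃ - F₃ * G₁')) := by
      have : DegLE c ((X + 1) ^ c * -(F₁ * G₃ - F₃ * G₁')) := by
        rw [← hmin]
        exact ((hF.degP.mul hG.degQ).mono (by omega)).sub ((hF.degQ.mul hG.degP).mono (by omega))
      exact this.of_X_add_one_pow_mul.mono (by omega)
    have hconst : F₁ * G₃ - F₃ * G₁' = C ((F₁ * G₃ - F₃ * G₁').coeff 0) := by
      refine eq_C_of_natDegree_eq_zero ?_
      rcases degLE_iff.mp hdeg with h | h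
      · rw [neg_eq_zero.mp h, natDegree_zero]
      · rw [natDegree_neg] at h; omega
    refine ⟨_, ?_, hconst⟩
    rw [coeff_zero_eq_eval_zero]
    simpa [hG₁'] using ⟨hxF, hxG⟩
  obtain ⟨κ, hκ, hdet⟩ := hdet
  have hu : C (F₃.eval (-1))⁻¹ * C (F₃.eval (-1)) = 1 := by rw [← C_mul, inv_mul_cancel₀ hzF, C_1]
  have hu' : C (G₃.eval (-1))⁻¹ * C (G₃.eval (-1)) = 1 := by
    rw [← C_mul, inv_mul_cancel₀ hzG, C_1]
  refine ⟨_, _, _, _, _, _, one_pos, hsum, hF.C_mul (F₃.eval (-1))⁻¹, hG.C_mul (G₃.eval (-1))⁻¹,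
    ⟨(F₃.eval (-1))⁻¹ * (G₃.eval (-1))⁻¹ * κ, ?_, ?_⟩, ?_, ?_, ?_, ⟨?_, ?_⟩, ?_, ?_, ?_, ?_⟩
  · simp [hκ, hzF, hzG]
  · rw [C_mul, C_mul, ← hdet]; ring
  · simp [hxF, hzF]
  · rw [pow_one]; exact (Dvd.intro _ rfl : X ∣ G₁').mul_left _
  · exact (hF'.degQ.C_mul _).mono (by push_cast; omega)
  · rw [natDegree_C_mul (inv_ne_zero hzG)]; exact hG₂
  · simp [hzG, hG20]
  · simp [X_add_one_dvd_iff, hzF]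
  · simp [X_add_one_dvd_iff, hzG]
  · rw [pow_one]; exact X_add_one_dvd_sub_C_eval
  · rw [pow_one]; exact X_add_one_dvd_sub_C_eval

/-- The Frobenius power of a normalized basis is a normalized basis. -/
theorem SyzBasis.frobenius (p : ℕ) (hp : p.Prime) [CharP F p] {a b c d : ℕ}
    {F₁ F₂ F₃ G₁ G₂ G₃ : F[X]} (h : SyzBasis a b c d 1 F₁ F₂ F₃ G₁ G₂ G₃) (n : ℕ) :
    SyzBasis (a * p ^ n) (b * p ^ n) (c * p ^ n) (d * p ^ n) (p ^ n) (F₁ ^ p ^ n) (F₂ ^ p ^ n)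
      (F₃ ^ p ^ n) (G₁ ^ p ^ n) (G₂ ^ p ^ n) (G₃ ^ p ^ n) := by
  have := Fact.mk hp
  have hq : p ^ n ≠ 0 := pow_ne_zero _ hp.ne_zero
  have hsyz : ∀ {P Q W : F[X]}, Syz a b c d P Q W →
      Syz (a * p ^ n) (b * p ^ n) (c * p ^ n) ((d * p ^ n : ℕ) : ℤ) (P ^ p ^ n) (Q ^ p ^ n)
        (W ^ p ^ n) := by
    intro P Q W h
    refine ⟨?_, ?_, ?_, ?_⟩
    · rw [pow_mul, pow_mul, ← mul_pow, ← mul_pow, ← add_pow_char_pow, ← add_pow_char_pow, h.rel,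
        zero_pow hq]
    · exact (h.degP.pow _).mono (by push_cast; linarith)
    · exact (h.degQ.pow _).mono (by push_cast; linarith)
    · exact (h.degW.pow _).mono (by push_cast; linarith)
  have hC : ∀ {f : F[X]} {t : F}, (X + 1) ^ 1 ∣ f - C t →
      (X + 1) ^ p ^ n ∣ f ^ p ^ n - C (t ^ p ^ n) := by
    intro f t h
    rw [C_pow, ← sub_pow_char_pow]
    rw [pow_one] at h
    exact pow_dvd_pow_of_dvd h _
  obtain ⟨κ, hκ, hdet⟩ := h.det
  refine ⟨Nat.pos_of_ne_zero hq, by rw [← add_mul, ← add_mul, h.total]; ring, hsyz h.hF, hsyz h.hG,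
    ⟨κ ^ p ^ n, pow_ne_zero _ hκ, ?_⟩, ?_, ?_, ?_, ⟨?_, ?_⟩, ?_, ?_,
    ?_, ?_⟩
  · rw [← mul_pow, ← mul_pow, ← sub_pow_char_pow, hdet, C_pow]
  · rw [eval_pow]; exact pow_ne_zero _ h.xF
  · have := h.xG
    rw [pow_one] at this
    exact pow_dvd_pow_of_dvd this _
  · exact (h.yF.pow _).mono (by push_cast; linarith)
  · rw [natDegree_pow, ← h.yG.1]; ring
  · exact pow_ne_zero _ h.yG.2
  · simpa using hC (t := 1) (by simpa using h.zF)
  · simpa using hC (t := 1) (by simpa using h.zG)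
  · rw [eval_pow]; exact hC h.zF₁
  · rw [eval_pow]; exact hC h.zG₁

end Basis

/-- There is a syzygy of `x ^ r`, `y ^ s`, `(x + y) ^ m` of degree `e` whose last component is
not divisible by `x + y`. -/
def HasUnitSyz (F : Type*) [Field F] (r s m : ℕ) (e : ℤ) : Prop :=
  ∃ P Q W : F[X], Syz r s m e P Q W ∧ W.eval (-1) ≠ 0

section Transfer

variable {F : Type*} [Field F] {a b c d q : ℕ} {F₁ F₂ F₃ G₁ G₂ G₃ : F[X]} {e : ℤ}

lemma eval_neg_one_X_add_one_pow_mul {k : ℕ} (hk : 0 < k) (f : F[X]) :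
    ((X + 1) ^ k * f).eval (-1) = 0 := by
  simp [zero_pow hk.ne']

lemma SyzBasis.eval_zF (h : SyzBasis a b c d q F₁ F₂ F₃ G₁ G₂ G₃) : F₃.eval (-1) = 1 := by
  have := (dvd_pow_self _ h.pos.ne').trans h.zF
  rwa [X_add_one_dvd_iff, eval_sub, eval_one, sub_eq_zero] at this

lemma SyzBasis.eval_zG (h : SyzBasis a b c d q F₁ F₂ F₃ G₁ G₂ G₃) : G₃.eval (-1) = 1 := by
  have := (dvd_pow_self _ h.pos.ne').trans h.zG
  rwa [X_add_one_dvd_iff, eval_sub, eval_one, sub_eq_zero] at this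

/-- Every syzygy is a polynomial combination of a basis. -/
lemma SyzBasis.exists_combination (h : SyzBasis a b c d q F₁ F₂ F₃ G₁ G₂ G₃) {P Q W : F[X]}
    (hs : Syz a b c e P Q W) :
    ∃ α β : F[X], DegLE (e - d) α ∧ DegLE (e - d) β ∧ P = α * F₁ + β * G₁ ∧
      Q = α * F₂ + β * G₂ ∧ W = α * F₃ + β * G₃ := by
  obtain ⟨κ, hκ, hdet⟩ := h.det
  have hu : C κ⁻¹ * C κ = 1 := by rw [← C_mul, inv_mul_cancel₀ hκ, C_1]
  have hP : P = C κ⁻¹ * (P * G₃ - W * G₁) * F₁ + C κ⁻¹ * (W * F₁ - P * F₃) * G₁ := by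
    linear_combination (-P) * hu - C κ⁻¹ * P * hdet
  have hW : W = C κ⁻¹ * (P * G₃ - W * G₁) * F₃ + C κ⁻¹ * (W * F₁ - P * F₃) * G₃ := by
    linear_combination (-W) * hu - C κ⁻¹ * W * hdet
  have htot := h.total
  refine ⟨C κ⁻¹ * (P * G₃ - W * G₁), C κ⁻¹ * (W * F₁ - P * F₃), ?_, ?_, hP, ?_, hW⟩
  · refine DegLE.C_mul _ ?_
    have h1 : X ^ a * (P * G₃ - W * G₁) = W * G₂ - Q * G₃ := by
      linear_combination G₃ * hs.rel - W * h.hG.rel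
    have h2 : DegLE (e - d + a) (X ^ a * (P * G₃ - W * G₁)) := by
      rw [h1]
      exact ((hs.degW.mul h.hG.degQ).mono (by omega)).sub
        ((hs.degQ.mul h.hG.degW).mono (by omega))
    exact h2.of_X_pow_mul.mono (by omega)
  · refine DegLE.C_mul _ ?_
    have h1 : X ^ a * (W * F₁ - P * F₃) = Q * F₃ - W * F₂ := by
      linear_combination W * h.hF.rel - F₃ * hs.rel
    have h2 : DegLE (e - d + a) (X ^ a * (W * F₁ - P * F₃)) := by
      rw [h1]
      exact ((hs.degQ.mul h.hF.degW).mono (by omega)).sub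
        ((hs.degW.mul h.hF.degQ).mono (by omega))
    exact h2.of_X_pow_mul.mono (by omega)
  · linear_combination hs.rel - X ^ a * hP - (X + 1) ^ c * hW -
      C κ⁻¹ * (P * G₃ - W * G₁) * h.hF.rel - C κ⁻¹ * (W * F₁ - P * F₃) * h.hG.rel

lemma SyzBasis.X_pow_dvd (h : SyzBasis a b c d q F₁ F₂ F₃ G₁ G₂ G₃) {α β : F[X]} {R : ℕ}
    (hR : R ≤ q) (hd : X ^ R ∣ α * F₁ + β * G₁) : X ^ R ∣ α := by
  have h1 : X ^ R ∣ α * F₁ :=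
    (dvd_add_left ((pow_dvd_pow X hR).trans (h.xG.mul_left β))).mp hd
  refine IsCoprime.dvd_of_dvd_mul_right (IsCoprime.pow_left ?_) h1
  refine (Irreducible.coprime_iff_not_dvd irreducible_X).mpr ?_
  rw [X_dvd_iff, coeff_zero_eq_eval_zero]
  exact h.xF

lemma SyzBasis.degLE_right (h : SyzBasis a b c d q F₁ F₂ F₃ G₁ G₂ G₃) {α β : F[X]} {S : ℕ}
    (hS : S ≤ q) (hα : DegLE (e - d) α) (hd : DegLE (e - b - S) (α * F₂ + β * G₂)) :
    DegLE (e - d - S) β := by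
  have h1 : DegLE (e - b - S) (G₂ * β) := by
    have : G₂ * β = (α * F₂ + β * G₂) - α * F₂ := by ring
    rw [this]
    exact hd.sub ((hα.mul h.yF).mono (by omega))
  have := h.yG.1
  exact (h1.of_mul h.yG.2).mono (by omega)

/-- Unit syzygies of the shifted exponents correspond to unit syzygies of the shifts. -/
theorem SyzBasis.hasUnitSyz_add_iff (h : SyzBasis a b c d q F₁ F₂ F₃ G₁ G₂ G₃) {R S j : ℕ}
    (hR : R ≤ q) (hS : S ≤ q) (hj : j < q) :
    HasUnitSyz F (a + R) (b + S) (c + j) e ↔ HasUnitSyz F R S j (e - d) := by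
  obtain ⟨K, hK⟩ := h.zF
  obtain ⟨L, hL⟩ := h.zG
  obtain ⟨i, rfl⟩ := Nat.exists_eq_add_of_lt hj
  constructor
  · rintro ⟨P, Q, W, hs, hW⟩
    have hs' : Syz a b c e (X ^ R * P) Q ((X + 1) ^ j * W) :=
      ⟨by linear_combination hs.rel, ((DegLE.X_pow R).mul hs.degP).mono (by push_cast; omega),
        hs.degQ.mono (by push_cast; omega),
        ((DegLE.X_add_one_pow j).mul hs.degW).mono (by push_cast; omega)⟩
    obtain ⟨α, β, hα, hβ, h1, h2, h3⟩ := h.exists_combination hs'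
    obtain ⟨α', rfl⟩ := h.X_pow_dvd hR (h1 ▸ Dvd.intro _ rfl)
    have hsum : X ^ R * α' + β + (X + 1) ^ j *
        ((X + 1) ^ (i + 1) * (X ^ R * α' * K + β * L) - W) = 0 := by
      linear_combination -(X ^ R * α') * hK - β * hL - h3
    refine ⟨α', β, (X + 1) ^ (i + 1) * (X ^ R * α' * K + β * L) - W, ⟨hsum, ?_, ?_, ?_⟩, ?_⟩
    · exact hα.of_X_pow_mul
    · exact h.degLE_right hS hα (h2 ▸ hs.degQ.mono (by push_cast; omega))
    · refine DegLE.of_X_add_one_pow_mul ?_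
      rw [show (X + 1) ^ j * ((X + 1) ^ (i + 1) * (X ^ R * α' * K + β * L) - W) =
        -(X ^ R * α' + β) by linear_combination hsum]
      exact (hα.add hβ).neg
    · rw [eval_sub, eval_neg_one_X_add_one_pow_mul (by omega), zero_sub]
      exact neg_ne_zero.mpr hW
  · rintro ⟨A, B, V, hs, hV⟩
    obtain ⟨g, hg⟩ := (pow_dvd_pow X hR).trans h.xG
    have hα : DegLE (e - d) (X ^ R * A) := ((DegLE.X_pow R).mul hs.degP).mono (by omega)
    have h3 : X ^ R * A * F₃ + B * G₃ = (X + 1) ^ j *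
        ((X + 1) ^ (i + 1) * (X ^ R * A * K + B * L) - V) := by
      linear_combination X ^ R * A * hK + B * hL + hs.rel
    refine ⟨A * F₁ + B * g, X ^ R * A * F₂ + B * G₂,
      (X + 1) ^ (i + 1) * (X ^ R * A * K + B * L) - V, ⟨?_, ?_, ?_, ?_⟩, ?_⟩
    · linear_combination X ^ R * A * h.hF.rel + B * h.hG.rel - X ^ a * B * hg - (X + 1) ^ c * h3
    · refine DegLE.mono (n := e - a - R) (DegLE.of_X_pow_mul ?_) (by push_cast; omega)
      rw [show X ^ R * (A * F₁ + B * g) = X ^ R * A * F₁ + B * G₁ by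
        linear_combination -B * hg]
      exact ((hα.mul h.hF.degP).mono (by omega)).add ((hs.degQ.mul h.hG.degP).mono (by omega))
    · exact ((hα.mul h.yF).mono (by push_cast; omega)).add
        ((hs.degQ.mul h.hG.degQ).mono (by push_cast; omega))
    · refine DegLE.mono (n := e - c - j) (DegLE.of_X_add_one_pow_mul ?_) (by push_cast; omega)
      rw [← h3]
      exact ((hα.mul h.hF.degW).mono (by omega)).add ((hs.degQ.mul h.hG.degW).mono (by omega))
    · rw [eval_sub, eval_neg_one_X_add_one_pow_mul (by omega), zero_sub]
      exact neg_ne_zero.mpr hV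

/-- The combination of basis elements produced by a unit syzygy of lower last exponent. -/
theorem SyzBasis.exists_of_hasUnitSyz_sub (h : SyzBasis a b c d q F₁ F₂ F₃ G₁ G₂ G₃)
    {R S j m : ℕ} (hR : R ≤ q) (hS : S ≤ q) (hj : j ≤ q) (hm : m + j = c)
    (hs : HasUnitSyz F (a + R) (b + S) m e) :
    ∃ α β : F[X], DegLE (e + j - d - R) α ∧ DegLE (e + j - d - S) β ∧
      (X + 1) ^ j ∣ C (F₁.eval (-1)) * (X ^ R * α) + C (G₁.eval (-1)) * β ∧
      (X ^ R * α).eval (-1) + β.eval (-1) ≠ 0 := by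
  obtain ⟨P, Q, W, hs, hW⟩ := hs
  obtain ⟨K, hK⟩ := h.zF₁
  obtain ⟨L, hL⟩ := h.zG₁
  have hs' : Syz a b c (e + j) ((X + 1) ^ j * (X ^ R * P)) ((X + 1) ^ j * Q) W := by
    refine ⟨?_, ?_, ?_, hs.degW.mono (by omega)⟩
    · rw [← hm]; linear_combination (X + 1) ^ j * hs.rel
    · exact ((DegLE.X_add_one_pow j).mul ((DegLE.X_pow R).mul hs.degP)).mono (by push_cast; omega)
    · exact ((DegLE.X_add_one_pow j).mul hs.degQ).mono (by push_cast; omega)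
  obtain ⟨α, β, hα, hβ, h1, h2, h3⟩ := h.exists_combination hs'
  obtain ⟨α', rfl⟩ := h.X_pow_dvd (α := α) (β := β) hR ⟨(X + 1) ^ j * P, by linear_combination -h1⟩
  refine ⟨α', β, hα.of_X_pow_mul, h.degLE_right hS hα ?_, ?_, ?_⟩
  · rw [← h2]
    exact ((DegLE.X_add_one_pow j).mul hs.degQ).mono (by push_cast; omega)
  · obtain ⟨i, rfl⟩ := Nat.exists_eq_add_of_le hj
    refine ⟨X ^ R * P - (X + 1) ^ i * (X ^ R * α' * K + β * L), ?_⟩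
    linear_combination -h1 - X ^ R * α' * hK - β * hL
  · intro h0
    apply hW
    rw [h3, eval_add, eval_mul, eval_mul (p := β), h.eval_zF, h.eval_zG, mul_one, mul_one, h0]

theorem SyzBasis.hasUnitSyz_sub_iff (h : SyzBasis a b c d q F₁ F₂ F₃ G₁ G₂ G₃)
    {R S j m : ℕ} (hR : R ≤ q) (hS : S ≤ q) (hj : j ≤ q) (hj0 : 0 < j) (hm : m + j = c)
    (hF₁ : F₁.eval (-1) ≠ 0) (hG₁ : G₁.eval (-1) ≠ 0) :
    HasUnitSyz F (a + R) (b + S) m e ↔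
      ∃ A B V : F[X], Syz R S j (e + j - d) A B V ∧ A.eval (-1) ≠ 0 := by
  constructor
  · intro hs
    obtain ⟨α, β, hα, hβ, ⟨V, hV⟩, h0⟩ := h.exists_of_hasUnitSyz_sub hR hS hj hm hs
    refine ⟨C (F₁.eval (-1)) * α, C (G₁.eval (-1)) * β, -V, ⟨by linear_combination hV, hα.C_mul _,
      hβ.C_mul _, DegLE.neg (DegLE.of_X_add_one_pow_mul ?_)⟩, ?_⟩
    · rw [← hV]
      exact (DegLE.C_mul _ (((DegLE.X_pow R).mul hα).mono (by omega))).add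
        ((hβ.C_mul _).mono (by omega))
    · intro hz
      have hz' : α.eval (-1) = 0 := by simpa [hF₁] using hz
      have := congrArg (eval (-1)) hV
      rw [eval_neg_one_X_add_one_pow_mul hj0] at this
      simp [hz', hG₁] at this
      simp [hz', this] at h0
  · rintro ⟨A, B, V, hs, hA⟩
    obtain ⟨K, hK⟩ := h.zF₁
    obtain ⟨L, hL⟩ := h.zG₁
    obtain ⟨g, hg⟩ := (pow_dvd_pow X hR).trans h.xG
    obtain ⟨i, rfl⟩ := Nat.exists_eq_add_of_le hj
    obtain ⟨κ, hκ, hdet⟩ := h.det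
    replace hdet := congrArg (eval (-1)) hdet
    rw [eval_sub, eval_mul, eval_mul, h.eval_zF, h.eval_zG, mul_one, one_mul, eval_C] at hdet
    set f := F₁.eval (-1) with hf
    set γ := G₁.eval (-1) with hγ
    have hu : C f⁻¹ * C f = 1 := by rw [← C_mul, inv_mul_cancel₀ hF₁, C_1]
    have hv : C γ⁻¹ * C γ = 1 := by rw [← C_mul, inv_mul_cancel₀ hG₁, C_1]
    have hα : DegLE (e + j - d) (X ^ R * (C f⁻¹ * A)) :=
      ((DegLE.X_pow R).mul (hs.degP.C_mul _)).mono (by omega)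
    have hβ : DegLE (e + j - d - S) (C γ⁻¹ * B) := hs.degQ.C_mul _
    obtain ⟨U, hU⟩ : (X + 1) ^ j ∣ X ^ R * (C f⁻¹ * A) * F₁ + C γ⁻¹ * B * G₁ := by
      refine ⟨X ^ R * (C f⁻¹ * A) * (X + 1) ^ i * K + C γ⁻¹ * B * (X + 1) ^ i * L - V, ?_⟩
      linear_combination X ^ R * (C f⁻¹ * A) * hK + (C γ⁻¹ * B) * hL + X ^ R * A * hu + B * hv +
        hs.rel
    obtain ⟨P, rfl⟩ : X ^ R ∣ U := by
      refine (isCoprime_X_X_add_one.pow (m := R) (n := j)).dvd_of_dvd_mul_left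
        ⟨C f⁻¹ * A * F₁ + C γ⁻¹ * B * g, ?_⟩
      linear_combination -hU + C γ⁻¹ * B * hg
    set W := X ^ R * (C f⁻¹ * A) * F₃ + C γ⁻¹ * B * G₃ with hW
    have hQ : (X + 1) ^ j * -(X ^ (a + R) * P + (X + 1) ^ m * W) =
        X ^ R * (C f⁻¹ * A) * F₂ + C γ⁻¹ * B * G₂ := by
      rw [hW]
      have h1 := h.hF.rel
      have h2 := h.hG.rel
      rw [← hm] at h1 h2
      linear_combination X ^ a * hU - X ^ R * (C f⁻¹ * A) * h1 - C γ⁻¹ * B * h2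
    refine ⟨P, -(X ^ (a + R) * P + (X + 1) ^ m * W), W, ⟨by ring, ?_, ?_, ?_⟩, ?_⟩
    · refine DegLE.mono (n := e + j - a - j - R)
        (DegLE.of_X_pow_mul (DegLE.of_X_add_one_pow_mul ?_)) (by push_cast; omega)
      rw [← hU]
      exact ((hα.mul h.hF.degP).mono (by omega)).add ((hβ.mul h.hG.degP).mono (by omega))
    · refine DegLE.mono (n := e + j - b - S - j) (DegLE.of_X_add_one_pow_mul ?_)
        (by push_cast; omega)
      rw [hQ]
      exact ((hα.mul h.yF).mono (by push_cast; omega)).add ((hβ.mul h.hG.degQ).mono (by omega))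
    · exact ((hα.mul h.hF.degW).mono (by omega)).add ((hβ.mul h.hG.degW).mono (by omega))
    · intro h0
      have h1 := congrArg (eval (-1)) hs.rel
      rw [eval_add, eval_neg_one_X_add_one_pow_mul hj0] at h1
      rw [hW, eval_add, eval_mul, eval_mul (p := C γ⁻¹ * B), h.eval_zF, h.eval_zG] at h0
      simp only [eval_add, eval_mul, eval_pow, eval_X, eval_C, mul_one, add_zero, eval_zero]
        at h0 h1
      have hR1 : ((-1 : F)) ^ R ≠ 0 := by simp
      field_simp at h0
      have h2 : (-1) ^ R * A.eval (-1) * κ = 0 := by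
        rw [← hdet]
        linear_combination f * h1 - h0
      simp [hA, hκ] at h2

end Transfer

section Nonvanishing

variable {F : Type*} [Field F] {a b c d q : ℕ} {F₁ F₂ F₃ G₁ G₂ G₃ : F[X]}

lemma SyzBasis.eval_F₁_ne_zero (p : ℕ) [CharP F p]
    (h : SyzBasis a b c d 1 F₁ F₂ F₃ G₁ G₂ G₃) (ha : a ≤ d) (hb : b < d) (hc : c ≤ d) (hc0 : 0 < c)
    (hdp : d < p) : F₁.eval (-1) ≠ 0 := by
  intro h0
  have htot := h.total
  obtain ⟨P, rfl⟩ := X_add_one_dvd_iff.mpr h0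
  obtain ⟨i, rfl⟩ := Nat.exists_eq_add_of_lt hc0
  simp only [zero_add] at *
  have hrel := h.hF.rel
  have hF₂ : F₂ = (X + 1) * -(X ^ a * P + (X + 1) ^ i * F₃) := by linear_combination hrel
  have hs : Syz a (b + 1) i ((d : ℤ) - 1) P (-(X ^ a * P + (X + 1) ^ i * F₃)) F₃ := by
    refine ⟨by ring, ?_, ?_, h.hF.degW.mono (by push_cast; omega)⟩
    · have := h.hF.degP
      rw [← pow_one (X + 1)] at this
      exact this.of_X_add_one_pow_mul.mono (by push_cast; omega)
    · have := h.yF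
      rw [hF₂, ← pow_one (X + 1)] at this
      simp only [pow_one] at this
      rw [show (X + 1 : F[X]) * -(X ^ a * P + (X + 1) ^ i * F₃) =
        (X + 1) ^ 1 * -(X ^ a * P + (X + 1) ^ i * F₃) by ring] at this
      exact this.of_X_add_one_pow_mul.mono (by push_cast; omega)
  have := hs.eq_zero p (by push_cast; omega) (by push_cast; omega) (by omega)
    (by push_cast; omega) (by omega)
  simpa [this.2.2] using h.eval_zF

lemma SyzBasis.eval_G₁_ne_zero (p : ℕ) [CharP F p]
    (h : SyzBasis a b c d 1 F₁ F₂ F₃ G₁ G₂ G₃) (ha : a < d) (hb : b ≤ d) (hc : c ≤ d) (hc0 : 0 < c)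
    (hdp : d < p) : G₁.eval (-1) ≠ 0 := by
  intro h0
  have htot := h.total
  obtain ⟨g, rfl, hs⟩ := h.hG.dvd_X (by simpa using h.xG)
  obtain ⟨P, rfl⟩ : (X + 1) ∣ g := by
    rw [X_add_one_dvd_iff]
    simpa using h0
  obtain ⟨i, rfl⟩ := Nat.exists_eq_add_of_lt hc0
  simp only [zero_add] at *
  have hG₂ : G₂ = (X + 1) ^ 1 * -(X ^ (a + 1) * P + (X + 1) ^ i * G₃) := by
    linear_combination hs.rel
  have hs : Syz (a + 1) b i ((d : ℤ) - 1) P (-(X ^ (a + 1) * P + (X + 1) ^ i * G₃)) G₃ := by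
    refine ⟨by ring, ?_, ?_, hs.degW.mono (by push_cast; omega)⟩
    · have := hs.degP
      rw [← pow_one (X + 1)] at this
      exact this.of_X_add_one_pow_mul.mono (by push_cast; omega)
    · have := hs.degQ
      rw [hG₂] at this
      exact this.of_X_add_one_pow_mul.mono (by push_cast; omega)
  have := hs.eq_zero p (by push_cast; omega) (by push_cast; omega) (by push_cast; omega)
    (by omega) (by omega)
  simpa [this.2.2] using h.eval_zG

/-- A basis normalized to order `p ^ n`. -/
theorem exists_syzBasis_frobenius (F : Type*) [Field F] (p : ℕ) (hp : p.Prime) [CharP F p] (n : ℕ)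
    {a b c d : ℕ}
    (hsum : a + b + c = 2 * d) (ha : a ≤ d) (hb : b ≤ d) (hc : c ≤ d) (hdp : d < p) :
    ∃ F₁ F₂ F₃ G₁ G₂ G₃ : F[X],
      SyzBasis (a * p ^ n) (b * p ^ n) (c * p ^ n) (d * p ^ n) (p ^ n) F₁ F₂ F₃ G₁ G₂ G₃ ∧
      (b < d → 0 < c → F₁.eval (-1) ≠ 0) ∧ (a < d → 0 < c → G₁.eval (-1) ≠ 0) := by
  obtain ⟨F₁, F₂, F₃, G₁, G₂, G₃, h⟩ := exists_syzBasis (F := F) p hsum ha hb hc hdp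
  refine ⟨_, _, _, _, _, _, h.frobenius p hp n, fun hb' hc0 => ?_, fun ha' hc0 => ?_⟩
  · rw [eval_pow]
    exact pow_ne_zero _ (h.eval_F₁_ne_zero p ha hb' hc hc0 hdp)
  · rw [eval_pow]
    exact pow_ne_zero _ (h.eval_G₁_ne_zero p ha' hb hc hc0 hdp)

lemma Syz.frobenius (p : ℕ) (hp : p.Prime) [CharP F p] {e : ℤ} {P Q W : F[X]}
    (h : Syz a b c e P Q W) (n : ℕ) :
    Syz (a * p ^ n) (b * p ^ n) (c * p ^ n) (e * (p ^ n : ℕ)) (P ^ p ^ n) (Q ^ p ^ n)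
      (W ^ p ^ n) := by
  have := Fact.mk hp
  have hq : p ^ n ≠ 0 := pow_ne_zero _ hp.ne_zero
  refine ⟨?_, ?_, ?_, ?_⟩
  · rw [pow_mul, pow_mul, ← mul_pow, ← mul_pow, ← add_pow_char_pow, ← add_pow_char_pow, h.rel,
      zero_pow hq]
  · exact (h.degP.pow (p ^ n)).mono (by push_cast; linarith)
  · exact (h.degQ.pow (p ^ n)).mono (by push_cast; linarith)
  · exact (h.degW.pow (p ^ n)).mono (by push_cast; linarith)

lemma HasUnitSyz.frobenius (p : ℕ) (hp : p.Prime) [CharP F p] {e : ℤ}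
    (h : HasUnitSyz F a b c e) (n : ℕ) :
    HasUnitSyz F (a * p ^ n) (b * p ^ n) (c * p ^ n) (e * (p ^ n : ℕ)) := by
  obtain ⟨P, Q, W, hs, hW⟩ := h
  exact ⟨_, _, _, hs.frobenius p hp n, by rw [eval_pow]; exact pow_ne_zero _ hW⟩

lemma HasUnitSyz.add {e : ℤ} (h : HasUnitSyz F a b c e) (R S : ℕ) :
    HasUnitSyz F (a + R) (b + S) c (e + R + S) := by
  obtain ⟨P, Q, W, hs, hW⟩ := h
  refine ⟨P, X ^ R * Q, X ^ R * W, ⟨by linear_combination X ^ R * hs.rel, ?_, ?_, ?_⟩, ?_⟩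
  · exact hs.degP.mono (by push_cast; omega)
  · exact ((DegLE.X_pow R).mul hs.degQ).mono (by push_cast; omega)
  · exact ((DegLE.X_pow R).mul hs.degW).mono (by omega)
  · simp [hW]

lemma HasUnitSyz.mono {e e' : ℤ} {a' b' : ℕ} (h : HasUnitSyz F a b c e) (ha : a' ≤ a)
    (hb : b' ≤ b) (he : e ≤ e') : HasUnitSyz F a' b' c e' := by
  obtain ⟨P, Q, W, hs, hW⟩ := h
  obtain ⟨i, rfl⟩ := Nat.exists_eq_add_of_le ha
  refine ⟨X ^ i * P, Q, W, ⟨by linear_combination hs.rel, ?_, ?_, ?_⟩, hW⟩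
  · exact ((DegLE.X_pow i).mul hs.degP).mono (by push_cast; omega)
  · exact hs.degQ.mono (by omega)
  · exact hs.degW.mono (by omega)

theorem hasUnitSyz_of_odd (p : ℕ) [CharP F p] (hsum : a + b + c = 2 * d + 1) (ha : a ≤ d + 1)
    (hb : b ≤ d + 1) (hc : c ≤ d) (hdp : d < p) : HasUnitSyz F a b c d := by
  obtain ⟨P, Q, W, hs, h0⟩ := exists_syz (F := F) hsum ha hb (by omega)
  refine ⟨P, Q, W, hs, fun hW => h0 ?_⟩
  obtain ⟨W', rfl, hs'⟩ := hs.dvd_X_add_one (X_add_one_dvd_iff.mpr hW)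
  have := hs'.eq_zero p (by push_cast; omega) (by omega) (by push_cast; omega)
    (by push_cast; omega) (by omega)
  exact ⟨this.1, this.2.1, by rw [this.2.2, mul_zero]⟩

end Nonvanishing

section Split

variable {F : Type*} [Field F] {r s m : ℕ} {e : ℤ}

/-- A polynomial with a gap in its coefficients splits accordingly. -/
lemma exists_split {f : F[X]} (hf : DegLE e f) (h : ∀ n : ℕ, n < r → e - s < n → f.coeff n = 0) :
    ∃ P Q : F[X], f = X ^ r * P + Q ∧ DegLE (e - r) P ∧ DegLE (e - s) Q := by
  set Q : F[X] := ∑ i ∈ Finset.range r, C (f.coeff i) * X ^ i with hQ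
  have hc : ∀ n, Q.coeff n = if n < r then f.coeff n else 0 := by
    intro n
    simp [hQ, coeff_C_mul, coeff_X_pow]
  obtain ⟨P, hP⟩ : X ^ r ∣ f - Q := by
    rw [X_pow_dvd_iff]
    intro d hd
    simp [hc, hd]
  refine ⟨P, Q, by linear_combination hP, DegLE.of_X_pow_mul ?_, fun n hn => ?_⟩
  · rw [← hP]
    intro n hn
    simp [hc, hf n hn]
  · rw [hc]
    split_ifs with h1
    · exact h n h1 hn
    · rfl

lemma hasUnitSyz_iff : HasUnitSyz F r s m e ↔ ∃ W : F[X], DegLE (e - m) W ∧ W.eval (-1) ≠ 0 ∧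
    ∀ n : ℕ, n < r → e - s < n → ((X + 1) ^ m * W).coeff n = 0 := by
  constructor
  · rintro ⟨P, Q, W, h, hW⟩
    refine ⟨W, h.degW, hW, fun n hn hn' => ?_⟩
    rw [show (X + 1) ^ m * W = -(X ^ r * P) - Q by linear_combination h.rel, coeff_sub, coeff_neg,
      h.degQ n hn', coeff_X_pow_mul', if_neg (by omega), neg_zero, sub_zero]
  · rintro ⟨W, hd, hW, hc⟩
    obtain ⟨P, Q, hf, hP, hQ⟩ :=
      exists_split (((DegLE.X_add_one_pow m).mul hd).mono (by omega)) hc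
    exact ⟨-P, -Q, W, ⟨by linear_combination hf, hP.neg, hQ.neg, hd⟩, hW⟩

lemma hasUnitSyz_of_add_le (hm : m ≤ e) (h : r + s ≤ e + 1) : HasUnitSyz F r s m e := by
  refine hasUnitSyz_iff.mpr ⟨1, DegLE.one.mono (by omega), by simp, fun n h1 h2 => ?_⟩
  omega

lemma X_add_one_pow_char_pow (p : ℕ) (hp : p.Prime) [CharP F p] (n : ℕ) :
    (X + 1 : F[X]) ^ p ^ n = X ^ p ^ n + 1 := by
  have := Fact.mk hp
  rw [add_pow_char_pow, one_pow]

lemma not_hasUnitSyz_pred_char_pow (p : ℕ) (hp : p.Prime) [CharP F p] {n l : ℕ}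
    (hr : r ≤ p ^ n) (hs : s ≤ p ^ n) (hl : l + p ^ n < r + s) :
    ¬ HasUnitSyz F r s (p ^ n - 1) (l + (p ^ n - 1 : ℕ)) := by
  rintro ⟨P, Q, W, h, hW⟩
  have hq : 0 < p ^ n := pow_pos hp.pos _
  have hz : (X + 1 : F[X]) * (X + 1) ^ (p ^ n - 1) = X ^ p ^ n + 1 := by
    rw [← pow_succ', Nat.sub_add_cancel hq, X_add_one_pow_char_pow p hp]
  have h0 : (X + 1) ^ 1 * Q + W = 0 := by
    refine DegLE.eq_zero_of_dvd (f := X ^ r) (n := r - 1) ?_ ?_ ?_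
    · refine DegLE.add (((DegLE.X_add_one_pow 1).mul h.degQ).mono ?_) (h.degW.mono ?_)
      · omega
      · omega
    · rw [show (X + 1) ^ 1 * Q + W = -(X ^ r * ((X + 1) * P)) - X ^ p ^ n * W by
        linear_combination (X + 1) * h.rel - W * hz]
      refine dvd_sub (dvd_neg.mpr ?_) ?_
      · exact dvd_mul_right _ _
      · exact (pow_dvd_pow X hr).mul_right _
    · simp
  have := congrArg (eval (-1)) h0
  rw [eval_add, eval_neg_one_X_add_one_pow_mul one_pos] at this
  exact hW (by simpa using this)

lemma hasUnitSyz_char_pow (p : ℕ) (hp : p.Prime) [CharP F p] {n : ℕ} (hr : r ≤ p ^ n)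
    (hs : s ≤ p ^ n) (he : (p ^ n : ℕ) ≤ e) : HasUnitSyz F r s (p ^ n) e := by
  refine ⟨X ^ (p ^ n - r), 1, -1, ⟨?_, ?_, ?_, ?_⟩, by simp⟩
  · rw [X_add_one_pow_char_pow p hp, ← pow_add, Nat.add_sub_cancel' hr]
    ring
  · exact (DegLE.X_pow _).mono (by omega)
  · exact DegLE.one.mono (by omega)
  · exact DegLE.one.neg.mono (by omega)

end Split

section Duality

variable {F : Type*} [Field F] {R S k w j : ℕ}

/-- The span of `(x + y) ^ j`, `x ^ R`, `y ^ S` in degree `k - 2`. -/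
def idealDegree (F : Type*) [Field F] (R S k j : ℕ) : Submodule F F[X] where
  carrier := {f | ∃ V A B : F[X], DegLE ((k : ℤ) - 2 - j) V ∧ DegLE ((k : ℤ) - 2 - R) A ∧
    DegLE ((k : ℤ) - 2 - S) B ∧ f = (X + 1) ^ j * V + X ^ R * A + B}
  add_mem' := by
    rintro _ _ ⟨V, A, B, hV, hA, hB, rfl⟩ ⟨V', A', B', hV', hA', hB', rfl⟩
    exact ⟨V + V', A + A', B + B', hV.add hV', hA.add hA', hB.add hB', by ring⟩
  zero_mem' := ⟨0, 0, 0, DegLE.zero, DegLE.zero, DegLE.zero, by ring⟩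
  smul_mem' := by
    rintro c _ ⟨V, A, B, hV, hA, hB, rfl⟩
    refine ⟨C c * V, C c * A, C c * B, hV.C_mul c, hA.C_mul c, hB.C_mul c, ?_⟩
    rw [smul_eq_C_mul]
    ring

lemma hasUnitSyz_of_functional (hw : k + w = R + S) (φ : F[X] →ₗ[F] F)
    (hφ : ∀ f ∈ idealDegree F R S k j, φ f = 0)
    (hτ : φ (∑ i ∈ Finset.range R, (-1) ^ i * X ^ (R - 1 - i)) ≠ 0) :
    HasUnitSyz F R S j ((w + j : ℕ) : ℤ) := by
  set W : F[X] := ∑ i ∈ Finset.range R, C (φ (X ^ (R - 1 - i))) * X ^ i with hW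
  have hc : ∀ n, W.coeff n = if n < R then φ (X ^ (R - 1 - n)) else 0 := by
    intro n
    simp [hW, coeff_C_mul, coeff_X_pow]
  have hlow : ∀ i : ℕ, (i : ℤ) ≤ k - 2 - S → φ (X ^ i) = 0 := fun i hi =>
    hφ _ ⟨0, 0, X ^ i, DegLE.zero, DegLE.zero, (DegLE.X_pow i).mono hi, by ring⟩
  have hhigh : ∀ i : ℕ, R ≤ i → (i : ℤ) ≤ k - 2 → φ (X ^ i) = 0 := fun i hi hi' =>
    hφ _ ⟨0, X ^ (i - R), 0, DegLE.zero, (DegLE.X_pow _).mono (by omega), DegLE.zero, by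
      rw [← pow_add, Nat.add_sub_cancel' hi]; ring⟩
  refine hasUnitSyz_iff.mpr ⟨W, ?_, ?_, ?_⟩
  · intro n hn
    rw [hc]
    split_ifs with h1
    · exact hlow _ (by omega)
    · rfl
  · convert hτ
    rw [hW, map_sum, eval_finsetSum]
    refine Finset.sum_congr rfl fun i _ => ?_
    rw [show ((-1) ^ i * X ^ (R - 1 - i) : F[X]) = ((-1 : F) ^ i) • X ^ (R - 1 - i) by
      simp [smul_eq_C_mul], map_smul]
    rw [eval_mul, eval_C, eval_pow, eval_X, smul_eq_mul, mul_comm]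
  · intro n hn hn'
    have h0 : φ ((X + 1) ^ j * X ^ (R - 1 - n)) = 0 :=
      hφ _ ⟨X ^ (R - 1 - n), 0, 0, (DegLE.X_pow _).mono (by omega), DegLE.zero, DegLE.zero,
        by ring⟩
    rw [← h0, as_sum_range_C_mul_X_pow ((X + 1 : F[X]) ^ j), Finset.sum_mul, Finset.sum_mul,
      map_sum, finsetSum_coeff]
    refine Finset.sum_congr rfl fun i hi => ?_
    rw [natDegree_X_add_one_pow, Finset.mem_range] at hi
    rw [mul_assoc, mul_assoc, coeff_C_mul, ← smul_eq_C_mul, map_smul, smul_eq_mul,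
      coeff_X_pow_mul', ← pow_add]
    congr 1
    split_ifs with h1
    · rw [hc, if_pos (by omega)]
      congr 2
      omega
    · exact (hhigh _ (by omega) (by omega)).symm

/-- Duality between unit syzygies in complementary degrees. -/
theorem exists_syz_iff_not_hasUnitSyz (hR : R < k) (hS : S < k) (hw : k + w = R + S) :
    (∃ A B V : F[X], Syz R S (j + 1) ((k : ℤ) - 1) A B V ∧ A.eval (-1) ≠ 0) ↔
      ¬ HasUnitSyz F R S j ((w + j : ℕ) : ℤ) := by
  constructor
  · rintro ⟨A, B, V, h, hA⟩ ⟨A', B', V', h', hV'⟩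
    have h1 : A * B' - A' * B = 0 := by
      refine DegLE.eq_zero_of_dvd (f := (X + 1) ^ j) (n := (j : ℤ) - 1) ?_ ?_ ?_
      · exact ((h.degP.mul h'.degQ).mono (by push_cast; omega)).sub
          ((h'.degP.mul h.degQ).mono (by push_cast; omega))
      · refine (isCoprime_X_X_add_one.symm.pow (m := j) (n := R)).dvd_of_dvd_mul_left
          ⟨V' * B - (X + 1) * V * B', ?_⟩
        linear_combination B' * h.rel - B * h'.rel
      · rw [natDegree_X_add_one_pow]
        omega
    have h2 : (X + 1) ^ j * (V' * B - (X + 1) * V * B') = 0 := by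
      linear_combination X ^ R * h1 - B' * h.rel + B * h'.rel
    have h3 := (mul_eq_zero.mp h2).resolve_left (pow_ne_zero _ X_add_one_ne_zero)
    have h4 := congrArg (eval (-1)) h3
    have h5 := congrArg (eval (-1)) h.rel
    simp at h4 h5
    simp [h4.resolve_left hV', hA] at h5
  · intro hn
    by_cases hτ : (∑ i ∈ Finset.range R, (-1) ^ i * X ^ (R - 1 - i) : F[X]) ∈
        idealDegree F R S k j
    · obtain ⟨V, A, B, hV, hA, hB, h⟩ := hτ
      have hg := (Commute.all (-1 : F[X]) X).geom_sum₂_mul R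
      rw [h] at hg
      refine ⟨1 - (X + 1) ^ 1 * A, -(-1) ^ R - (X + 1) ^ 1 * B, -V, ⟨?_, ?_, ?_, ?_⟩, ?_⟩
      · linear_combination hg
      · exact (DegLE.one.mono (by omega)).sub
          (((DegLE.X_add_one_pow 1).mul hA).mono (by push_cast; omega))
      · refine DegLE.sub ?_ (((DegLE.X_add_one_pow 1).mul hB).mono (by push_cast; omega))
        exact DegLE.neg (((DegLE.one.neg).pow R).mono (by simp; omega))
      · exact hV.neg.mono (by push_cast; omega)
      · simp
    · obtain ⟨φ, h1, h2⟩ := Submodule.exists_le_ker_of_notMem hτ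
      exact absurd (hasUnitSyz_of_functional hw φ (fun f hf => h2 hf) h1) hn

end Duality

section JordanType

variable {F : Type*} [Field F] {r s : ℕ} {e : ℤ}

/-- The tensor in `M(r,s)` of a homogeneous polynomial of degree `e` in `x`, `y`, dehomogenized at
`y = 1`; here `v_{r,s}` corresponds to `1` and `T` to multiplication by `x + y`. -/
def ofPoly (r s : ℕ) (e : ℤ) : F[X] →ₗ[F] Matrix (Fin r) (Fin s) F where
  toFun W := Matrix.of fun i j => if (i : ℤ) + j + e + 2 = r + s then W.coeff (r - 1 - i) else 0
  map_add' V W := by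
    ext i j
    simp only [Matrix.of_apply, Matrix.add_apply, coeff_add]
    split_ifs <;> simp
  map_smul' c W := by
    ext i j
    simp

/-- The projection of `M(r,s)` to degree `e`. -/
def degreeProj (r s : ℕ) (e : ℤ) :
    Matrix (Fin r) (Fin s) F →ₗ[F] Matrix (Fin r) (Fin s) F where
  toFun A := Matrix.of fun i j => if (i : ℤ) + j + e + 2 = r + s then A i j else 0
  map_add' A B := by
    ext i j
    simp only [Matrix.of_apply, Matrix.add_apply]
    split_ifs <;> simp
  map_smul' c W := by
    ext i j
    simp

lemma ofPoly_apply (W : F[X]) (i : Fin r) (j : Fin s) : ofPoly r s e W i j =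
    if (i : ℤ) + j + e + 2 = r + s then W.coeff (r - 1 - i) else 0 := rfl

lemma degreeProj_apply (A : Matrix (Fin r) (Fin s) F) (i : Fin r) (j : Fin s) :
    degreeProj r s e A i j = if (i : ℤ) + j + e + 2 = r + s then A i j else 0 := rfl

lemma TT_apply (A : Matrix (Fin r) (Fin s) F) (i : Fin r) (j : Fin s) : TT F r s A i j =
    (if h : (i : ℕ) + 1 < r then A ⟨(i : ℕ) + 1, h⟩ j else 0) +
    (if h : (j : ℕ) + 1 < s then A i ⟨(j : ℕ) + 1, h⟩ else 0) := rfl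

lemma TT_degreeProj (A : Matrix (Fin r) (Fin s) F) :
    TT F r s (degreeProj r s e A) = degreeProj r s (e + 1) (TT F r s A) := by
  ext i j
  simp only [TT_apply, degreeProj_apply]
  by_cases h : (i : ℤ) + j + (e + 1) + 2 = r + s
  · rw [if_pos h]
    congr 1 <;>
    · split_ifs <;> first | rfl | (push_cast at *; omega)
  · rw [if_neg h]
    split_ifs <;> first | (push_cast at *; omega) | simp

lemma TT_pow_degreeProj (A : Matrix (Fin r) (Fin s) F) (m : ℕ) :
    (TT F r s ^ m) (degreeProj r s e A) = degreeProj r s (e + m) ((TT F r s ^ m) A) := by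
  induction m with
  | zero => simp
  | succ m ih =>
    rw [pow_succ', Module.End.mul_apply, ih, TT_degreeProj, Module.End.mul_apply]
    push_cast
    ring_nf

lemma TT_ofPoly {W : F[X]} (hW : DegLE e W) :
    TT F r s (ofPoly r s e W) = ofPoly r s (e + 1) ((X + 1) * W) := by
  ext i j
  simp only [TT_apply, ofPoly_apply, add_mul, one_mul, coeff_add]
  by_cases h : (i : ℤ) + j + (e + 1) + 2 = r + s
  · rw [if_pos h]
    congr 1
    · split_ifs with h1 h2
      · rw [show r - 1 - (i : ℕ) = r - 1 - (i + 1) + 1 by omega, coeff_X_mul]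
      · push_cast at *; omega
      · rw [show r - 1 - (i : ℕ) = 0 by omega, coeff_X_mul_zero]
    · split_ifs with h1 h2
      · rfl
      · push_cast at *; omega
      · exact (hW _ (by omega)).symm
  · rw [if_neg h]
    split_ifs <;> first | (push_cast at *; omega) | simp

lemma TT_pow_ofPoly {W : F[X]} (hW : DegLE e W) (m : ℕ) :
    (TT F r s ^ m) (ofPoly r s e W) = ofPoly r s (e + m) ((X + 1) ^ m * W) := by
  induction m with
  | zero => simp
  | succ m ih =>
    rw [pow_succ', Module.End.mul_apply, ih,
      TT_ofPoly (((DegLE.X_add_one_pow m).mul hW).mono (by omega))]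
    congr 1
    · push_cast; ring_nf
    · ring

lemma degreeProj_ofPoly {e' : ℤ} (W : F[X]) :
    degreeProj r s e' (ofPoly r s e W) = if e' = e then ofPoly r s e W else 0 := by
  ext i j
  rw [degreeProj_apply]
  by_cases he : e' = e
  · subst he
    rw [if_pos rfl, ofPoly_apply]
    split_ifs <;> rfl
  · rw [if_neg he, ofPoly_apply]
    split_ifs
    · omega
    · rfl
    · rfl

lemma exists_ofPoly_eq_degreeProj (e : ℤ) (A : Matrix (Fin r) (Fin s) F) :
    ∃ W : F[X], DegLE e W ∧ ofPoly r s e W = degreeProj r s e A := by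
  classical
  let c : ℕ → F := fun n => ∑ i : Fin r, ∑ j : Fin s,
    if (i : ℤ) + n + 1 = r ∧ (i : ℤ) + j + e + 2 = r + s then A i j else 0
  have hc : ∀ n : ℕ, (∑ n ∈ Finset.range r, C (c n) * X ^ n : F[X]).coeff n =
      if n < r then c n else 0 := by
    intro n
    simp [coeff_C_mul, coeff_X_pow]
  refine ⟨∑ n ∈ Finset.range r, C (c n) * X ^ n, fun n hn => ?_, ?_⟩
  · rw [hc]
    split_ifs with h1
    · refine Finset.sum_eq_zero fun i _ => Finset.sum_eq_zero fun j _ => if_neg ?_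
      omega
    · rfl
  · ext i j
    rw [ofPoly_apply, degreeProj_apply]
    split_ifs with h
    · rw [hc, if_pos (by omega)]
      simp only [c]
      rw [Finset.sum_eq_single i, Finset.sum_eq_single j]
      · rw [if_pos]
        omega
      · intro b _ hb
        refine if_neg fun h' => hb (Fin.ext ?_)
        omega
      · simp
      · intro b _ hb
        refine Finset.sum_eq_zero fun j _ => if_neg fun h' => hb (Fin.ext ?_)
        omega
      · simp
    · rfl

/-- Modulo multiples of `x + y`, every form of degree `e` is a multiple of `x ^ e`. -/
lemma exists_eq_C_mul_X_pow_add {e : ℕ} {W : F[X]} (hW : DegLE e W) :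
    ∃ U : F[X], DegLE ((e : ℤ) - 1) U ∧
      W = C ((-1) ^ e * W.eval (-1)) * X ^ e + (X + 1) * U := by
  obtain ⟨U, hU⟩ : (X + 1) ∣ W - C ((-1) ^ e * W.eval (-1)) * X ^ e := by
    rw [X_add_one_dvd_iff]
    simp only [eval_sub, eval_mul, eval_C, eval_pow, eval_X]
    have : ((-1 : F) ^ e) * (-1) ^ e = 1 := by rw [← mul_pow]; simp
    linear_combination -(W.eval (-1)) * this
  refine ⟨U, ?_, by linear_combination hU⟩
  have : DegLE (e : ℤ) ((X + 1) ^ 1 * U) := by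
    rw [pow_one, ← hU]
    exact hW.sub ((DegLE.X_pow e).C_mul _)
  exact this.of_X_add_one_pow_mul

lemma TT_pow_ofPoly_X_pow_mem_range_iff (m i : ℕ) :
    (TT F r s ^ m) (ofPoly r s i (X ^ i)) ∈ LinearMap.range (TT F r s ^ (m + 1)) ↔
      HasUnitSyz F r s m ((i + m : ℕ) : ℤ) := by
  rw [hasUnitSyz_iff]
  constructor
  · rintro ⟨v, hv⟩
    obtain ⟨U, hU, hU'⟩ := exists_ofPoly_eq_degreeProj ((i : ℤ) - 1) v
    have h1 := congrArg (degreeProj r s (i + m)) hv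
    have hX : DegLE (i : ℤ) (X ^ i : F[X]) := DegLE.X_pow i
    have h2 : DegLE (i : ℤ) ((X + 1) ^ 1 * U) :=
      ((DegLE.X_add_one_pow 1).mul hU).mono (by push_cast; omega)
    rw [show (i : ℤ) + m = i - 1 + (m + 1 : ℕ) by push_cast; ring, ← TT_pow_degreeProj,
      ← hU', TT_pow_ofPoly hU, TT_pow_ofPoly hX, degreeProj_ofPoly, if_pos (by push_cast; ring),
      show (i : ℤ) - 1 + (m + 1 : ℕ) = i + m by push_cast; ring] at h1
    refine ⟨X ^ i - (X + 1) ^ 1 * U, (hX.sub h2).mono (by push_cast; omega), by simp, ?_⟩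
    intro n hn hn'
    by_cases hn2 : n ≤ i + m
    · have h3 : ofPoly r s (i + m : ℤ) ((X + 1) ^ m * (X ^ i - (X + 1) ^ 1 * U)) = 0 := by
        rw [← sub_eq_zero, ← map_sub] at h1
        rw [← neg_eq_zero, ← h1, ← map_neg]
        congr 1
        ring
      have h4 := congrFun (congrFun h3 ⟨r - 1 - n, by omega⟩) ⟨s - 1 - (i + m - n), by
        push_cast at hn'; omega⟩
      rw [ofPoly_apply, if_pos (by push_cast at *; omega)] at h4
      simpa [show r - 1 - (r - 1 - n) = n by omega] using h4
    · exact ((DegLE.X_add_one_pow m).mul (hX.sub h2)) n (by omega)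
  · rintro ⟨W, hW, hW1, hc⟩
    replace hW : DegLE (i : ℤ) W := hW.mono (by push_cast; omega)
    obtain ⟨U, hU, hWU⟩ := exists_eq_C_mul_X_pow_add hW
    have h0 : ofPoly r s (i + m : ℤ) ((X + 1) ^ m * W) = 0 := by
      ext a b
      rw [ofPoly_apply]
      split_ifs with h
      · exact hc _ (by omega) (by push_cast; omega)
      · rfl
    have h1 : ofPoly r s (i : ℤ) W = ((-1) ^ i * W.eval (-1)) • ofPoly r s (i : ℤ) (X ^ i) +
        TT F r s (ofPoly r s (i - 1) U) := by
      rw [TT_ofPoly hU, ← map_smul, sub_add_cancel, ← map_add, smul_eq_C_mul, ← hWU]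
    rw [← TT_pow_ofPoly hW, h1, map_add, map_smul] at h0
    have hu : (-1) ^ i * W.eval (-1) ≠ 0 := by simp [hW1]
    rw [← Submodule.smul_mem_iff _ hu, eq_neg_of_add_eq_zero_left h0, neg_mem_iff,
      ← Module.End.mul_apply, ← pow_succ]
    exact LinearMap.mem_range_self _ _

end JordanType

section Count

variable {F : Type*} [Field F] {r s : ℕ}

lemma ofPoly_X_pow_mem (r s e : ℕ) : ofPoly r s e (X ^ e : F[X]) ∈
    Submodule.span F ((fun i : ℕ => ofPoly r s i (X ^ i : F[X])) '' Set.Iio (min r s)) ⊔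
      LinearMap.range (TT F r s) := by
  by_cases he : e < min r s
  · exact Submodule.mem_sup_left (Submodule.subset_span ⟨e, he, rfl⟩)
  by_cases her : r ≤ e
  · convert Submodule.zero_mem _
    ext i j
    rw [ofPoly_apply, coeff_X_pow, if_neg (show r - 1 - (i : ℕ) ≠ e by omega), ite_self]
    rfl
  · obtain ⟨U, hU, h1⟩ := exists_eq_C_mul_X_pow_add (F := F) (e := e) (W := 1)
      (DegLE.one.mono (by omega))
    refine Submodule.mem_sup_right ?_
    have h0 : ofPoly r s e (1 : F[X]) = 0 := by
      ext i j
      rw [ofPoly_apply]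
      split_ifs with h
      · rw [coeff_one, if_neg (by omega)]
        rfl
      · rfl
    rw [h1, map_add, eval_one, mul_one, ← smul_eq_C_mul, map_smul,
      ← sub_add_cancel (e : ℤ) 1, ← TT_ofPoly hU, sub_add_cancel] at h0
    rw [← Submodule.smul_mem_iff _ (show ((-1 : F) ^ e) ≠ 0 by simp),
      eq_neg_of_add_eq_zero_left h0, neg_mem_iff]
    exact LinearMap.mem_range_self _ _

lemma span_ofPoly_sup_range_TT (r s : ℕ) :
    Submodule.span F ((fun i : ℕ => ofPoly r s i (X ^ i : F[X])) '' Set.Iio (min r s)) ⊔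
      LinearMap.range (TT F r s) = ⊤ := by
  refine eq_top_iff.mpr fun A _ => ?_
  have hA : A = ∑ e ∈ Finset.range (r + s), degreeProj r s e A := by
    ext i j
    rw [Matrix.sum_apply, Finset.sum_eq_single (r + s - 2 - i - j)]
    · rw [degreeProj_apply, if_pos (by omega)]
    · intro e _ he
      rw [degreeProj_apply, if_neg (by omega)]
    · intro h
      rw [Finset.mem_range] at h
      omega
  rw [hA]
  refine Submodule.sum_mem _ fun e _ => ?_
  obtain ⟨W, hW, h⟩ := exists_ofPoly_eq_degreeProj (e : ℤ) A
  obtain ⟨U, hU, hWU⟩ := exists_eq_C_mul_X_pow_add hW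
  rw [← h, hWU, map_add, ← smul_eq_C_mul, map_smul]
  refine add_mem (Submodule.smul_mem _ _ (ofPoly_X_pow_mem r s e)) (Submodule.mem_sup_right ?_)
  rw [← sub_add_cancel (e : ℤ) 1, ← TT_ofPoly hU]
  exact LinearMap.mem_range_self _ _

open Classical in
theorem finrank_range_TT_pow (F : Type*) [Field F] (r s m : ℕ) :
    Module.finrank F (LinearMap.range (TT F r s ^ m)) =
      ((Finset.range (min r s)).filter fun i => ¬ HasUnitSyz F r s m ((i + m : ℕ) : ℤ)).card +
      Module.finrank F (LinearMap.range (TT F r s ^ (m + 1))) := by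
  set S := (Finset.range (min r s)).filter fun i => ¬ HasUnitSyz F r s m ((i + m : ℕ) : ℤ) with hS
  set U := LinearMap.range (TT F r s ^ (m + 1)) with hU
  set V := LinearMap.range (TT F r s ^ m) with hV
  let v : S → Matrix (Fin r) (Fin s) F := fun i => (TT F r s ^ m) (ofPoly r s (i : ℕ) (X ^ (i : ℕ)))
  have hUV : U ≤ V := by
    rintro _ ⟨x, rfl⟩
    rw [pow_succ, Module.End.mul_apply]
    exact LinearMap.mem_range_self _ _
  have hli : LinearIndependent F (U.mkQ ∘ v) := by
    rw [Fintype.linearIndependent_iff]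
    intro g hg i
    by_contra hgi
    have h1 : ∑ i, g i • v i ∈ U := by
      rw [← Submodule.Quotient.mk_eq_zero, ← Submodule.mkQ_apply, map_sum, ← hg]
      simp
    obtain ⟨y, hy⟩ := h1
    have h2 : g i • v i ∈ U := by
      refine ⟨degreeProj r s ((i : ℕ) - 1 : ℤ) y, ?_⟩
      rw [TT_pow_degreeProj, hy, map_sum, Finset.sum_eq_single i]
      · simp only [v]
        rw [TT_pow_ofPoly (DegLE.X_pow _), map_smul, degreeProj_ofPoly,
          if_pos (by push_cast; ring)]
      · intro k _ hk
        simp only [v]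
        rw [TT_pow_ofPoly (DegLE.X_pow _), map_smul, degreeProj_ofPoly, if_neg, smul_zero]
        intro h
        apply hk
        ext
        push_cast at h
        omega
      · simp
    rw [Submodule.smul_mem_iff _ hgi] at h2
    have h3 := (Finset.mem_filter.mp i.2).2
    exact h3 ((TT_pow_ofPoly_X_pow_mem_range_iff m i).mp h2)
  have hmap : V.map U.mkQ = Submodule.span F (Set.range (U.mkQ ∘ v)) := by
    apply le_antisymm
    · rw [Set.range_comp, ← Submodule.map_span, hV, LinearMap.range_eq_map,
        ← span_ofPoly_sup_range_TT, Submodule.map_sup, Submodule.map_sup]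
      refine sup_le ?_ ?_
      · rw [Submodule.map_span (TT F r s ^ m), Submodule.map_span, Submodule.span_le]
        rintro _ ⟨_, ⟨_, ⟨i, hi, rfl⟩, rfl⟩, rfl⟩
        by_cases hiS : i ∈ S
        · exact ⟨_, Submodule.subset_span ⟨⟨i, hiS⟩, rfl⟩, rfl⟩
        · have h1 : HasUnitSyz F r s m ((i + m : ℕ) : ℤ) := by
            by_contra h
            exact hiS (Finset.mem_filter.mpr ⟨Finset.mem_range.mpr hi, h⟩)
          rw [← TT_pow_ofPoly_X_pow_mem_range_iff] at h1
          rw [Submodule.mkQ_apply, (Submodule.Quotient.mk_eq_zero U).mpr h1]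
          exact Submodule.zero_mem _
      · rintro _ ⟨_, ⟨_, ⟨y, rfl⟩, rfl⟩, rfl⟩
        rw [← Module.End.mul_apply, ← pow_succ, Submodule.mkQ_apply,
          (Submodule.Quotient.mk_eq_zero U).mpr (LinearMap.mem_range_self _ _)]
        exact Submodule.zero_mem _
    · rw [Submodule.span_le]
      rintro _ ⟨i, rfl⟩
      exact ⟨_, LinearMap.mem_range_self _ _, rfl⟩
  have h1 := LinearMap.finrank_range_add_finrank_ker (U.mkQ.domRestrict V)
  rw [LinearMap.range_domRestrict, hmap, finrank_span_eq_card hli, Fintype.card_coe,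
    LinearMap.ker_domRestrict, Submodule.ker_mkQ,
    (Submodule.comapSubtypeEquivOfLe hUV).finrank_eq] at h1
  exact h1.symm

/-- The parts of the Jordan type are detected by unit syzygies. -/
theorem IsJordanType.le_iff {lam : ℕ → ℕ} (h : IsJordanType F r s lam) {l : ℕ} (hl : l < min r s)
    (m : ℕ) : lam (l + 1) ≤ m ↔ HasUnitSyz F r s m ((l + m : ℕ) : ℤ) := by
  classical
  have hcard := h.2.2 (m + 1) (by omega)
  rw [Nat.add_sub_cancel, finrank_range_TT_pow, Nat.add_sub_cancel] at hcard
  constructor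
  · intro hlm
    by_contra hn
    have h1 : Finset.range (l + 1) ⊆ (Finset.range (min r s)).filter
        fun i => ¬ HasUnitSyz F r s m ((i + m : ℕ) : ℤ) := by
      intro i hi
      rw [Finset.mem_range] at hi
      exact Finset.mem_filter.mpr ⟨Finset.mem_range.mpr (by omega),
        fun h' => hn (h'.mono le_rfl le_rfl (by push_cast; omega))⟩
    have h2 : (Finset.Icc 1 (min r s)).filter (fun l => m + 1 ≤ lam l) ⊆ Finset.Icc 1 l := by
      intro i hi
      obtain ⟨hi, hi'⟩ := Finset.mem_filter.mp hi
      rw [Finset.mem_Icc] at hi ⊢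
      refine ⟨hi.1, ?_⟩
      by_contra hc
      have := h.2.1 (l + 1) i (by omega) (by omega) hi.2
      omega
    have h3 := Finset.card_le_card h1
    have h4 := Finset.card_le_card h2
    simp only [Finset.card_range, Nat.card_Icc] at h3 h4
    omega
  · intro hu
    by_contra! hn
    have h1 : (Finset.range (min r s)).filter
        (fun i => ¬ HasUnitSyz F r s m ((i + m : ℕ) : ℤ)) ⊆ Finset.range l := by
      intro i hi
      rw [Finset.mem_range]
      by_contra hc
      exact (Finset.mem_filter.mp hi).2 (hu.mono le_rfl le_rfl (by push_cast; omega))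
    have h2 : Finset.Icc 1 (l + 1) ⊆ (Finset.Icc 1 (min r s)).filter (fun l => m + 1 ≤ lam l) := by
      intro i hi
      rw [Finset.mem_Icc] at hi
      refine Finset.mem_filter.mpr ⟨Finset.mem_Icc.mpr ⟨hi.1, by omega⟩, ?_⟩
      have := h.2.1 i (l + 1) hi.1 hi.2 (by omega)
      omega
    have h3 := Finset.card_le_card h1
    have h4 := Finset.card_le_card h2
    simp only [Finset.card_range, Nat.card_Icc] at h3 h4
    omega

end Count

section Parts

variable {F : Type*} [Field F] {r s : ℕ} {lam mu : ℕ → ℕ}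

lemma IsJordanType.eq_of_hasUnitSyz (h : IsJordanType F r s lam) {l v : ℕ} (hl : l < min r s)
    (hv : 0 < v) (h1 : HasUnitSyz F r s v ((l : ℤ) + v))
    (h2 : ¬ HasUnitSyz F r s (v - 1) ((l : ℤ) + v - 1)) : lam (l + 1) = v := by
  obtain ⟨v, rfl⟩ := Nat.exists_eq_add_of_lt hv
  rw [zero_add] at *
  have h3 := (h.le_iff hl (v + 1)).mpr (by simpa using h1)
  have h4 := mt (h.le_iff hl v).mp (by
    rw [Nat.add_sub_cancel] at h2
    convert h2 using 2
    push_cast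
    ring)
  omega

variable (p : ℕ) [CharP F p] {R S t a b k : ℕ}

theorem IsJordanType.eq_char_pow (hp : p.Prime) (n : ℕ) (h : IsJordanType F r s lam) {l : ℕ}
    (hr : r ≤ p ^ n) (hs : s ≤ p ^ n) (hl : l + p ^ n < r + s) : lam (l + 1) = p ^ n := by
  have hq : 0 < p ^ n := pow_pos hp.pos n
  refine h.eq_of_hasUnitSyz (by omega) hq (hasUnitSyz_char_pow p hp hr hs (by omega)) ?_
  have h1 := not_hasUnitSyz_pred_char_pow (F := F) p hp hr hs hl
  convert h1 using 2
  push_cast [hq]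
  ring

theorem IsJordanType.eq_of_add_lt (hp : p.Prime) (n : ℕ)
    (h : IsJordanType F ((t + a) * p ^ n + R) ((t + b) * p ^ n + S) lam)
    (hR : R < p ^ n) (hS : S < p ^ n) (hk : k + p ^ n < R + S) (hd : t + a + b + 1 < p)
    (hl : t * p ^ n + k < min ((t + a) * p ^ n + R) ((t + b) * p ^ n + S)) :
    lam (t * p ^ n + k + 1) = (a + b + 1) * p ^ n := by
  have hq : 0 < p ^ n := pow_pos hp.pos n
  refine h.eq_of_hasUnitSyz hl (by positivity) ?_ ?_
  · have h1 := (hasUnitSyz_of_odd (F := F) p (a := t + a + 1) (b := t + b + 1) (c := a + b + 1)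
      (d := t + a + b + 1) (by ring) (by omega) (by omega) (by omega) hd).frobenius p hp n
    refine h1.mono ?_ ?_ ?_
    · rw [add_one_mul]; omega
    · rw [add_one_mul]; omega
    · push_cast; linarith
  · obtain ⟨F₁, F₂, F₃, G₁, G₂, G₃, hB, -⟩ := exists_syzBasis_frobenius F p hp n
      (a := t + a) (b := t + b) (c := a + b) (d := t + a + b) (by ring) (by omega) (by omega)
      (by omega) (by omega)
    rw [show (a + b + 1) * p ^ n - 1 = (a + b) * p ^ n + (p ^ n - 1) by rw [add_one_mul]; omega,
      hB.hasUnitSyz_add_iff hR.le hS.le (by omega)]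
    have h1 := not_hasUnitSyz_pred_char_pow (F := F) p hp hR.le hS.le hk
    convert h1 using 2
    push_cast [hq]
    ring

theorem IsJordanType.eq_add (hp : p.Prime) (n : ℕ)
    (h : IsJordanType F ((t + a) * p ^ n + R) ((t + b) * p ^ n + S) lam)
    (hmu : IsJordanType F R S mu)
    (hR : R < p ^ n) (hS : S < p ^ n) (hk : R + S ≤ k + p ^ n) (hk' : k < min R S)
    (hd : t + a + b < p)
    (hl : t * p ^ n + k < min ((t + a) * p ^ n + R) ((t + b) * p ^ n + S)) :
    lam (t * p ^ n + k + 1) = (a + b) * p ^ n + mu (k + 1) := by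
  have hq : 0 < p ^ n := pow_pos hp.pos n
  obtain ⟨F₁, F₂, F₃, G₁, G₂, G₃, hB, -⟩ := exists_syzBasis_frobenius F p hp n
    (a := t + a) (b := t + b) (c := a + b) (d := t + a + b) (by ring) (by omega) (by omega)
    (by omega) hd
  have hle : ∀ j < p ^ n, lam (t * p ^ n + k + 1) ≤ (a + b) * p ^ n + j ↔ mu (k + 1) ≤ j := by
    intro j hj
    rw [h.le_iff hl, hmu.le_iff hk', hB.hasUnitSyz_add_iff hR.le hS.le hj]
    have : ((t * p ^ n + k + ((a + b) * p ^ n + j) : ℕ) : ℤ) - ((t + a + b) * p ^ n : ℕ) =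
        (k + j : ℕ) := by push_cast; ring
    rw [this]
  have h0 := hmu.1 (k + 1) (by omega) (by omega)
  have hlt : mu (k + 1) ≤ p ^ n - 1 :=
    (hmu.le_iff hk' _).mpr (hasUnitSyz_of_add_le (by push_cast; omega) (by omega))
  have h1 := (hle (mu (k + 1)) (by omega)).mpr le_rfl
  have h2 := mt (hle (mu (k + 1) - 1) (by omega)).mp (by omega)
  omega

theorem IsJordanType.eq_mul (hp : p.Prime) (n : ℕ)
    (h : IsJordanType F ((t + a) * p ^ n + R) ((t + b) * p ^ n + S) lam)
    (hR : R < p ^ n) (hS : S < p ^ n) (hk : min R S ≤ k) (hk' : k < max R S)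
    (hd : t + a + b < p)
    (hl : t * p ^ n + k < min ((t + a) * p ^ n + R) ((t + b) * p ^ n + S)) :
    lam (t * p ^ n + k + 1) = (a + b) * p ^ n := by
  have hq : 0 < p ^ n := pow_pos hp.pos n
  obtain ⟨F₁, F₂, F₃, G₁, G₂, G₃, hB, hF₁, hG₁⟩ := exists_syzBasis_frobenius F p hp n
    (a := t + a) (b := t + b) (c := a + b) (d := t + a + b) (by ring) (by omega) (by omega)
    (by omega) hd
  have hab : (R ≤ k ∧ 0 < a) ∨ (S ≤ k ∧ 0 < b) := by
    rcases le_total R S with h1 | h1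
    · refine Or.inl ⟨by omega, Nat.pos_of_ne_zero ?_⟩
      rintro rfl
      rw [add_zero] at hl
      omega
    · refine Or.inr ⟨by omega, Nat.pos_of_ne_zero ?_⟩
      rintro rfl
      rw [add_zero] at hl
      omega
  have hc : 0 < (a + b) * p ^ n := Nat.mul_pos (by omega) hq
  have hdeg : (((t * p ^ n + k : ℕ) : ℤ) + ((a + b) * p ^ n : ℕ)) - ((t + a + b) * p ^ n : ℕ) =
      k := by push_cast; ring
  refine h.eq_of_hasUnitSyz hl hc ?_ fun hu => ?_
  · rw [← add_zero ((a + b) * p ^ n), hB.hasUnitSyz_add_iff hR.le hS.le hq, add_zero, hdeg]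
    rcases hab with ⟨h1, -⟩ | ⟨h1, -⟩
    · exact ⟨-1, 0, X ^ R, ⟨by ring, DegLE.one.neg.mono (by omega), DegLE.zero,
        (DegLE.X_pow R).mono (by omega)⟩, by simp⟩
    · exact ⟨0, -1, 1, ⟨by ring, DegLE.zero, DegLE.one.neg.mono (by omega),
        DegLE.one.mono (by omega)⟩, by simp⟩
  · obtain ⟨α, β, hα, hβ, hd, h0⟩ := hB.exists_of_hasUnitSyz_sub (j := 1) hR.le hS.le hq
      (by omega) hu
    rw [pow_one, X_add_one_dvd_iff] at hd
    rcases le_total R S with h1 | h1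
    · rw [hβ.eq_zero (by push_cast at *; omega)] at hd h0
      simp [hF₁ (by omega) (by omega)] at hd h0
      exact h0 hd
    · rw [hα.eq_zero (by push_cast at *; omega)] at hd h0
      simp [hG₁ (by omega) (by omega)] at hd h0
      exact h0 hd

theorem IsJordanType.eq_sub (hp : p.Prime) (n : ℕ)
    (h : IsJordanType F ((t + a) * p ^ n + R) ((t + b) * p ^ n + S) lam)
    (hmu : IsJordanType F R S mu)
    (hR : R < p ^ n) (hS : S < p ^ n) (hk : max R S ≤ k) (hk' : k < R + S) (hkq : k < p ^ n)
    (hd : t + a + b < p)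
    (hl : t * p ^ n + k < min ((t + a) * p ^ n + R) ((t + b) * p ^ n + S)) :
    lam (t * p ^ n + k + 1) + mu (R + S - k) = (a + b) * p ^ n := by
  have hq : 0 < p ^ n := pow_pos hp.pos n
  obtain ⟨F₁, F₂, F₃, G₁, G₂, G₃, hB, hF₁, hG₁⟩ := exists_syzBasis_frobenius F p hp n
    (a := t + a) (b := t + b) (c := a + b) (d := t + a + b) (by ring) (by omega) (by omega)
    (by omega) hd
  have ha : 0 < a := by
    refine Nat.pos_of_ne_zero ?_
    rintro rfl
    rw [add_zero] at hl
    omega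
  have hb : 0 < b := by
    refine Nat.pos_of_ne_zero ?_
    rintro rfl
    rw [add_zero] at hl
    omega
  obtain ⟨w, hw⟩ := Nat.exists_eq_add_of_lt hk'
  have hw' : w < min R S := by omega
  have hc : p ^ n ≤ (a + b) * p ^ n := Nat.le_mul_of_pos_left _ (by omega)
  rw [show R + S - k = w + 1 by omega]
  have hle : ∀ i < p ^ n,
      lam (t * p ^ n + k + 1) ≤ (a + b) * p ^ n - (i + 1) ↔ ¬ mu (w + 1) ≤ i := by
    intro i hi
    rw [h.le_iff hl, hmu.le_iff hw', hB.hasUnitSyz_sub_iff hR.le hS.le (j := i + 1) (by omega)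
      (by omega) (by omega) (hF₁ (by omega) (by omega)) (hG₁ (by omega) (by omega)),
      ← exists_syz_iff_not_hasUnitSyz (k := k + 1) (by omega) (by omega) (by omega)]
    have : ((t * p ^ n + k + ((a + b) * p ^ n - (i + 1)) : ℕ) : ℤ) + (i + 1 : ℕ) -
        ((t + a + b) * p ^ n : ℕ) = (k + 1 : ℕ) - 1 := by
      rw [Nat.cast_add, Nat.cast_sub (by omega)]
      push_cast
      ring
    rw [this]
  have h0 := hmu.1 (w + 1) (by omega) (by omega)
  have hlt : mu (w + 1) ≤ p ^ n - 1 :=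
    (hmu.le_iff hw' _).mpr (hasUnitSyz_of_add_le (by push_cast; omega) (by omega))
  have h1 := (hle (mu (w + 1) - 1) (by omega)).mpr (by omega)
  have h2 := mt (hle (mu (w + 1)) (by omega)).mp (by omega)
  omega

theorem IsJordanType.eq_of_add_le (hp : p.Prime) (n : ℕ)
    (h : IsJordanType F ((t + 1 + a) * p ^ n + R) ((t + 1 + b) * p ^ n + S) lam)
    (hR : R < p ^ n) (hS : S < p ^ n) (hk : R + S ≤ k) (hkq : k < p ^ n)
    (hd : t + 1 + a + b < p)
    (hl : t * p ^ n + k < min ((t + 1 + a) * p ^ n + R) ((t + 1 + b) * p ^ n + S)) :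
    lam (t * p ^ n + k + 1) = (a + b + 1) * p ^ n := by
  have hq : 0 < p ^ n := pow_pos hp.pos n
  refine h.eq_of_hasUnitSyz hl (by positivity) ?_ ?_
  · have h1 := (hasUnitSyz_of_odd (F := F) p (a := t + 1 + a) (b := t + 1 + b) (c := a + b + 1)
      (d := t + 1 + a + b) (by ring) (by omega) (by omega) (by omega) hd).frobenius p hp n
    refine (h1.add R S).mono le_rfl le_rfl ?_
    push_cast
    linarith
  · obtain ⟨F₁, F₂, F₃, G₁, G₂, G₃, hB, -⟩ := exists_syzBasis_frobenius F p hp n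
      (a := t + 1 + a) (b := t + 1 + b) (c := a + b) (d := t + 1 + a + b) (by ring) (by omega)
      (by omega) (by omega) hd
    rw [show (a + b + 1) * p ^ n - 1 = (a + b) * p ^ n + (p ^ n - 1) by rw [add_one_mul]; omega,
      hB.hasUnitSyz_add_iff hR.le hS.le (by omega)]
    rintro ⟨P, Q, W, hs, hW⟩
    refine hW ?_
    rw [hs.degW.eq_zero, eval_zero]
    have hkq' : (k : ℤ) < (p ^ n : ℕ) := by exact_mod_cast hkq
    push_cast [hq] at *
    linarith

end Parts

/-- Renaud's theorem identifying the parts `lambda_l` of the Jordan type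
of `V_r ⊗ V_s`. -/
theorem stmt0 (p : ℕ) (hp : p.Prime) (F : Type*) [Field F] [CharP F p]
    (r s n rn sn R S : ℕ) (hr : 0 < r) (hs : 0 < s)
    (hn1 : p ^ n ≤ max r s) (hn2 : max r s < p ^ (n + 1))
    (hrn : rn < p) (hsn : sn < p) (hRp : R < p ^ n) (hSp : S < p ^ n)
    (hrd : r = rn * p ^ n + R) (hsd : s = sn * p ^ n + S)
    (lam : ℕ → ℕ) (hlam : IsJordanType F r s lam) :
    -- (i)
    (∀ l : ℕ, 1 ≤ l → (l : ℤ) ≤ (r : ℤ) + s - p ^ (n + 1) →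
      (lam l : ℤ) = (p : ℤ) ^ (n + 1)) ∧
    -- (ii)
    (∀ t k l : ℕ, l = t * p ^ n + k → 1 ≤ k → k ≤ p ^ n →
      max ((r : ℤ) + s - p ^ (n + 1)) 0 + 1 ≤ (l : ℤ) → l ≤ min r s →
      -- case m = 0
      ((min R S = 0 →
        ((1 ≤ k → k ≤ max R S →
            (lam l : ℤ) = ((rn : ℤ) + sn - 2 * t) * p ^ n) ∧
         (max R S + 1 ≤ k → k ≤ p ^ n →
            (lam l : ℤ) = ((rn : ℤ) + sn - 2 * t - 1) * p ^ n))) ∧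
      -- case m > 0
       (0 < min R S → ∀ mu : ℕ → ℕ, IsJordanType F R S mu →
        ((1 ≤ k → (k : ℤ) ≤ max ((R : ℤ) + S - p ^ n) 0 →
            (lam l : ℤ) = ((rn : ℤ) + sn - 2 * t + 1) * p ^ n) ∧
         (max ((R : ℤ) + S - p ^ n) 0 + 1 ≤ (k : ℤ) → k ≤ min R S →
            (lam l : ℤ) = ((rn : ℤ) + sn - 2 * t) * p ^ n + mu k) ∧
         (min R S + 1 ≤ k → k ≤ max R S →
            (lam l : ℤ) = ((rn : ℤ) + sn - 2 * t) * p ^ n) ∧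
         (max R S + 1 ≤ k → (k : ℤ) ≤ (p : ℤ) ^ n - max ((p : ℤ) ^ n - R - S) 0 →
            (lam l : ℤ) = ((rn : ℤ) + sn - 2 * t) * p ^ n -
              mu (min R S + max R S + 1 - k)) ∧
         ((p : ℤ) ^ n - max ((p : ℤ) ^ n - R - S) 0 + 1 ≤ (k : ℤ) → k ≤ p ^ n →
            (lam l : ℤ) = ((rn : ℤ) + sn - 2 * t - 1) * p ^ n))))) := by
  have hq : 0 < p ^ n := pow_pos hp.pos n
  refine ⟨fun l hl1 hl => ?_, ?_⟩
  · obtain ⟨l, rfl⟩ := Nat.exists_eq_add_of_le' hl1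
    rw [hlam.eq_char_pow p hp (n + 1) (by omega) (by omega) (by zify; push_cast at hl; linarith)]
    push_cast
    rfl
  subst hrd hsd
  rintro t k l rfl hk1 hkq hmax hmin
  obtain ⟨k, rfl⟩ := Nat.exists_eq_add_of_le' hk1
  have hmul : ∀ {x y : ℕ}, x ≤ y → x * p ^ n ≤ y * p ^ n := fun h => Nat.mul_le_mul_right _ h
  have htr : t ≤ rn := by
    by_contra! h
    have := hmul h
    rw [Nat.succ_mul] at this
    omega
  have hts : t ≤ sn := by
    by_contra! h
    have := hmul h
    rw [Nat.succ_mul] at this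
    omega
  obtain ⟨a, rfl⟩ := Nat.exists_eq_add_of_le htr
  obtain ⟨b, rfl⟩ := Nat.exists_eq_add_of_le hts
  have hsum : (t + a + b) * p ^ n + R + S ≤ p * p ^ n + k := by
    have := (add_le_add_left (le_max_left _ _) 1).trans hmax
    zify
    push_cast at this
    rw [pow_succ'] at this
    linarith
  have hl : t * p ^ n + k < min ((t + a) * p ^ n + R) ((t + b) * p ^ n + S) := by omega
  have hd₀ (h : k < R + S) : t + a + b < p := by
    by_contra! h'
    have := hmul h'
    omega
  have hd₁ (h : k + p ^ n < R + S) : t + a + b + 1 < p := by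
    by_contra! h'
    have := hmul h'
    rw [Nat.succ_mul] at this
    omega
  have hadd_lt (h : k + p ^ n < R + S) : (lam (t * p ^ n + (k + 1)) : ℤ) =
      (((t + a : ℕ) : ℤ) + (t + b : ℕ) - 2 * t + 1) * p ^ n := by
    rw [← add_assoc, hlam.eq_of_add_lt p hp n hRp hSp h (hd₁ h) hl]
    push_cast
    ring
  have hmid (h : min R S ≤ k) (h' : k < max R S) : (lam (t * p ^ n + (k + 1)) : ℤ) =
      (((t + a : ℕ) : ℤ) + (t + b : ℕ) - 2 * t) * p ^ n := by
    rw [← add_assoc, hlam.eq_mul p hp n hRp hSp h h' (hd₀ (by omega)) hl]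
    push_cast
    ring
  have hadd_le (h : R + S ≤ k) : (lam (t * p ^ n + (k + 1)) : ℤ) =
      (((t + a : ℕ) : ℤ) + (t + b : ℕ) - 2 * t - 1) * p ^ n := by
    have hd : t + a + b ≤ p := by
      by_contra! h'
      have := hmul h'
      rw [Nat.succ_mul] at this
      omega
    obtain _ | a := a
    · rw [add_zero] at hl
      omega
    obtain _ | b := b
    · rw [add_zero t] at hl
      omega
    rw [show t + (a + 1) = t + 1 + a by ring, show t + (b + 1) = t + 1 + b by ring] at *
    rw [← add_assoc, hlam.eq_of_add_le p hp n hRp hSp h (by omega) (by omega) hl]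
    push_cast
    ring
  refine ⟨fun hm => ⟨fun _ _ => hmid (by omega) (by omega), fun _ _ => hadd_le (by omega)⟩,
    fun hm mu hmu => ⟨fun _ h => hadd_lt ?_, fun h h' => ?_,
      fun _ _ => hmid (by omega) (by omega), fun h h' => ?_, fun h _ => hadd_le ?_⟩⟩
  · zify
    push_cast at h
    rcases le_max_iff.mp h with h | h <;> omega
  · have h₁ := (add_le_add_left (le_max_left _ _) 1).trans h
    rw [← add_assoc, hlam.eq_add p hp n hmu hRp hSp (by zify; push_cast at h₁; linarith) (by omega)
      (hd₀ (by omega)) hl]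
    push_cast
    ring
  · have h₁ := h'.trans (sub_le_sub_left (le_max_left _ _) _)
    have h₂ : k < R + S := by zify; push_cast at h₁; linarith
    have h₃ := hlam.eq_sub p hp n hmu hRp hSp (by omega) h₂ (by omega) (hd₀ h₂) hl
    rw [← add_assoc, show min R S + max R S + 1 - (k + 1) = R + S - k by omega]
    zify at h₃
    push_cast
    linarith
  · zify
    push_cast at h
    have hk : (k : ℤ) + 1 ≤ (p : ℤ) ^ n := by exact_mod_cast hkq
    rcases max_choice ((p : ℤ) ^ n - R - S) 0 with h' | h' <;> rw [h'] at h <;> linarith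
end
end

section
/- Let n and c be positive integers with c < p. Then for all integers a, b with 1 <= a <= r and 1 <= b <= s, one has in M(r,s): T^{c p^n}(v_{a,b}) = sum_{i=0}^{c} C(c, i) v_{a - c p^n + i p^n, b - i p^n}, where any symbol v_{c',d'} with c' <= 0 or d' <= 0 is read as 0. -/
open scoped BigOperators

noncomputable section

/-- The linear map `v_{i,j} ↦ v_{i-1,j}` on `M(r,s)`. -/
def rowShift (F : Type*) [Field F] (r s : ℕ) : Module.End F (Matrix (Fin r) (Fin s) F) where
  toFun A := Matrix.of fun i j => if h : (i : ℕ) + 1 < r then A ⟨(i : ℕ) + 1, h⟩ j else 0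
  map_add' A B := by
    ext i j
    simp only [Matrix.of_apply, Matrix.add_apply]
    split_ifs <;> simp
  map_smul' c A := by
    ext i j
    simp only [Matrix.of_apply, Matrix.smul_apply, RingHom.id_apply, smul_eq_mul]
    split_ifs <;> simp

/-- The linear map `v_{i,j} ↦ v_{i,j-1}` on `M(r,s)`. -/
def colShift (F : Type*) [Field F] (r s : ℕ) : Module.End F (Matrix (Fin r) (Fin s) F) where
  toFun A := Matrix.of fun i j => if h : (j : ℕ) + 1 < s then A i ⟨(j : ℕ) + 1, h⟩ else 0
  map_add' A B := by
    ext i j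
    simp only [Matrix.of_apply, Matrix.add_apply]
    split_ifs <;> simp
  map_smul' c A := by
    ext i j
    simp only [Matrix.of_apply, Matrix.smul_apply, RingHom.id_apply, smul_eq_mul]
    split_ifs <;> simp

section Shift

variable (F : Type*) [Field F] (r s : ℕ)

theorem TT_eq_colShift_add_rowShift : TT F r s = colShift F r s + rowShift F r s := by
  ext A i j
  simp [TT, rowShift, colShift, add_comm]

theorem commute_colShift_rowShift : Commute (colShift F r s) (rowShift F r s) := by
  refine LinearMap.ext fun A => ?_
  ext i j
  simp only [rowShift, colShift, Module.End.mul_apply, LinearMap.coe_mk, AddHom.coe_mk,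
    Matrix.of_apply]
  split_ifs <;> rfl

theorem rowShift_vv (a b : ℤ) (ha : a ≤ r) :
    rowShift F r s (vv F r s a b) = vv F r s (a - 1) b := by
  ext i j
  have hi := i.isLt
  simp only [rowShift, vv, LinearMap.coe_mk, AddHom.coe_mk, Matrix.of_apply]
  split_ifs <;> first | rfl | (exfalso; push_cast at *; omega)

theorem colShift_vv (a b : ℤ) (hb : b ≤ s) :
    colShift F r s (vv F r s a b) = vv F r s a (b - 1) := by
  ext i j
  have hj := j.isLt
  simp only [colShift, vv, LinearMap.coe_mk, AddHom.coe_mk, Matrix.of_apply]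
  split_ifs <;> first | rfl | (exfalso; push_cast at *; omega)

theorem rowShift_pow_vv (k : ℕ) (a b : ℤ) (ha : a ≤ r) :
    (rowShift F r s ^ k) (vv F r s a b) = vv F r s (a - k) b := by
  induction k with
  | zero => simp
  | succ k ih =>
    rw [pow_succ', Module.End.mul_apply, ih, rowShift_vv F r s _ _ (by omega)]
    congr 1
    push_cast
    ring

theorem colShift_pow_vv (k : ℕ) (a b : ℤ) (hb : b ≤ s) :
    (colShift F r s ^ k) (vv F r s a b) = vv F r s a (b - k) := by
  induction k with
  | zero => simp
  | succ k ih =>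
    rw [pow_succ', Module.End.mul_apply, ih, colShift_vv F r s _ _ (by omega)]
    congr 1
    push_cast
    ring

theorem TT_pow_mul_char_pow (p : ℕ) (hp : p.Prime) [CharP F p] (hr : 0 < r) (hs : 0 < s)
    (n c : ℕ) :
    TT F r s ^ (c * p ^ n) = (colShift F r s ^ p ^ n + rowShift F r s ^ p ^ n) ^ c := by
  have : Fact p.Prime := ⟨hp⟩
  have : Nonempty (Fin r) := ⟨⟨0, hr⟩⟩
  have : Nonempty (Fin s) := ⟨⟨0, hs⟩⟩
  have : Nontrivial (Matrix (Fin r) (Fin s) F) :=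
    inferInstanceAs (Nontrivial (Fin r → Fin s → F))
  have : CharP (Module.End F (Matrix (Fin r) (Fin s) F)) p :=
    charP_of_injective_algebraMap
      (algebraMap F (Module.End F (Matrix (Fin r) (Fin s) F))).injective p
  rw [mul_comm, pow_mul, TT_eq_colShift_add_rowShift,
    add_pow_char_pow_of_commute p n (commute_colShift_rowShift F r s)]

end Shift

/-- `T^{c p^n}(v_{a,b}) = ∑_{i=0}^c C(c,i) v_{a-cp^n+ip^n, b-ip^n}`. -/
theorem stmt4 (p : ℕ) (hp : p.Prime) (F : Type*) [Field F] [CharP F p]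
    (r s : ℕ) (hr : 0 < r) (hs : 0 < s)
    (n c : ℕ) (hn : 0 < n) (hc : 0 < c) (hcp : c < p) (a b : ℤ)
    (ha1 : 1 ≤ a) (ha2 : a ≤ r) (hb1 : 1 ≤ b) (hb2 : b ≤ s) :
    ((TT F r s) ^ (c * p ^ n)) (vv F r s a b) =
      ∑ i ∈ Finset.range (c + 1),
        (Nat.choose c i : F) •
          vv F r s (a - (c : ℤ) * p ^ n + (i : ℤ) * p ^ n) (b - (i : ℤ) * p ^ n) := by
  rw [TT_pow_mul_char_pow F r s p hp hr hs,
    ((commute_colShift_rowShift F r s).pow_pow _ _).add_pow, LinearMap.sum_apply]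
  refine Finset.sum_congr rfl fun i hi => ?_
  have hic : i ≤ c := Nat.lt_succ_iff.mp (Finset.mem_range.mp hi)
  rw [(Nat.cast_commute _ _).symm.eq, Module.End.mul_apply, Module.End.natCast_apply,
    Nat.cast_smul_eq_nsmul, Module.End.mul_apply, ← pow_mul, ← pow_mul,
    rowShift_pow_vv F r s _ _ _ ha2, colShift_pow_vv F r s _ _ _ hb2]
  congr 2 <;> push_cast [hic] <;> ring
end
end

section
/- Assume the k x k matrix Q over F with (i,j) entry C(a, b+j-i) is invertible. Define d_k = prod_{i=0}^{k-1} C(a+i,b)/C(b+i,b) as a rational number, and for 1 <= i,j <= k define the rational number z_{i,j} = (d_k / C(a+k-1, b+i-1)) * sum_{l=1}^{j} (-1)^{l+j} C(a+k-1, l-1) C(a+j-l-1, j-l) prod_{r=1, r != i}^{k} (l-b-r)/(i-r) (invertibility of Q forces b <= a, so these rationals are well defined). Then d_k and all z_{i,j} are integers, det Q = phi(d_k) is nonzero in F, and the inverse of Q is the k x k matrix N with (i,j) entry phi(d_k)^{-1} phi(z_{i,j}), where phi denotes the natural ring map from the integers to F. -/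
open scoped BigOperators

noncomputable section

open Finset Polynomial in
/-- Lagrange interpolation at the nodes `1, …, k`, in evaluated form. -/
theorem sum_eval_mul_lagrange {k : ℕ} {f : ℚ[X]} (hf : f.degree < k) (x : ℚ) :
    ∑ i ∈ Icc 1 k, f.eval (i : ℚ) * ∏ t ∈ Icc 1 k \ {i}, ((x - t) / ((i : ℚ) - t)) =
      f.eval x := by
  have h := Lagrange.eq_interpolate (s := Icc 1 k) (v := fun i : ℕ => (i : ℚ)) (f := f)
    (Nat.cast_injective.injOn) (by simpa using hf)
  conv_rhs => rw [h]
  simp only [Lagrange.interpolate_apply, Lagrange.basis, Lagrange.basisDivisor, eval_finsetSum,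
    eval_mul, eval_C, eval_prod, eval_sub, eval_X, sdiff_singleton_eq_erase]
  refine sum_congr rfl fun i _ => congrArg _ (prod_congr rfl fun t _ => ?_)
  rw [div_eq_mul_inv, mul_comm]

theorem choose_mul_descFactorial_mul_factorial {a m r c : ℕ}
    (hc : c ≤ a + m + r) :
    (a + m + r).choose c * (c.descFactorial m * (a + m + r - c).descFactorial r) * a.factorial =
      (a + m + r).factorial * if m ≤ c then a.choose (c - m) else 0 := by
  split_ifs with h
  · obtain ⟨e, rfl⟩ := Nat.exists_eq_add_of_le h
    rw [Nat.add_sub_cancel_left]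
    rcases le_or_gt e a with he | he
    · obtain ⟨g, rfl⟩ := Nat.exists_eq_add_of_le he
      have h1 := Nat.factorial_mul_descFactorial (Nat.le_add_right m e)
      have h2 := Nat.factorial_mul_descFactorial (Nat.le_add_left r g)
      have h3 := Nat.choose_mul_factorial_mul_factorial hc
      have h4 := Nat.choose_mul_factorial_mul_factorial he
      rw [show e + g + m + r - (m + e) = g + r by omega] at h3 ⊢
      rw [Nat.add_sub_cancel_left] at h1 h4
      rw [Nat.add_sub_cancel] at h2
      rw [← h3, ← h4, ← h1, ← h2]
      ring
    · rw [Nat.choose_eq_zero_of_lt he,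
        (Nat.descFactorial_eq_zero_iff_lt (n := a + m + r - (m + e)) (k := r)).2 (by omega)]
      simp
  · rw [(Nat.descFactorial_eq_zero_iff_lt (n := c) (k := m)).2 (by omega)]
    simp

open Polynomial in
/-- The quotient `C(a, c - m) / C(a + k - 1, c)` is a polynomial in `c` of degree less than `k`. -/
theorem exists_polynomial_choose_ratio (a : ℕ) {k m : ℕ} (hm : m < k) :
    ∃ f : ℚ[X], f.degree < k ∧ ∀ c : ℕ, c ≤ a + k - 1 →
      ((a + k - 1).choose c : ℚ) * f.eval (c : ℚ) =
        if m ≤ c then (a.choose (c - m) : ℚ) else 0 := by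
  obtain ⟨r, rfl⟩ : ∃ r, k = m + r + 1 := ⟨k - m - 1, by omega⟩
  have hn : a + (m + r + 1) - 1 = a + m + r := by omega
  rw [hn]
  refine ⟨C ((a.factorial : ℚ) / (a + m + r).factorial) * (descPochhammer ℚ m *
    (descPochhammer ℚ r).comp (C ((a + m + r : ℕ) : ℚ) - X)), ?_, fun c hc => ?_⟩
  · refine degree_le_natDegree.trans_lt (Nat.cast_lt.2 (Nat.lt_succ_of_le ?_))
    refine (natDegree_C_mul_le _ _).trans (natDegree_mul_le.trans ?_)
    rw [natDegree_comp, descPochhammer_natDegree, descPochhammer_natDegree]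
    have : (C ((a + m + r : ℕ) : ℚ) - X).natDegree ≤ 1 :=
      (natDegree_sub_le _ _).trans (by rw [natDegree_C, natDegree_X]; simp)
    nlinarith
  · have h := congrArg (Nat.cast : ℕ → ℚ) (choose_mul_descFactorial_mul_factorial hc)
    have h0 : ((a + m + r).factorial : ℚ) ≠ 0 := by positivity
    rw [eval_mul, eval_C, eval_mul, eval_comp, eval_sub, eval_C, eval_X, ← Nat.cast_sub hc,
      descPochhammer_eval_eq_descFactorial, descPochhammer_eval_eq_descFactorial]
    push_cast at h
    field_simp
    linear_combination h

open Finset in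
/-- The coefficients of `(1 + x) ^ a` and of its inverse series convolve to the identity. -/
theorem sum_antidiagonal_choose_mul_neg_choose (a n : ℕ) :
    ∑ x ∈ antidiagonal n, (a.choose x.1 : ℚ) * ((-1) ^ x.2 * ((a + x.2 - 1).choose x.2 : ℚ)) =
      if n = 0 then 1 else 0 := by
  have h := Ring.add_choose_eq n (Commute.neg_right (Commute.refl (a : ℤ)))
  rw [add_neg_cancel, Ring.choose_zero_ite] at h
  have h' := congrArg (Int.cast : ℤ → ℚ) h
  push_cast at h'
  rw [h']
  refine sum_congr rfl fun x _ => ?_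
  rcases Nat.eq_zero_or_pos x.2 with h0 | h0
  · simp [h0, Ring.choose_natCast]
  · rw [Ring.choose_neg, show (a : ℤ) + x.2 - 1 = ((a + x.2 - 1 : ℕ) : ℤ) by omega]
    simp [Ring.choose_natCast, Units.smul_def]

/-- The integer matrix with `(i, j)` entry `C(a, b + j - i)`. -/
def binomialToeplitz (a b k : ℕ) : Matrix (Fin k) (Fin k) ℤ :=
  Matrix.of fun i j => if (i : ℕ) ≤ b + j then (a.choose (b + j - i) : ℤ) else 0

/-- The entries (indexed from `1`) of the rational inverse of `binomialToeplitz a b k`. -/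
def binomialToeplitzInv (a b k i j : ℕ) : ℚ :=
  (1 / (Nat.choose (a + k - 1) (b + i - 1) : ℚ)) *
    ∑ l ∈ Finset.Icc 1 j, (-1 : ℚ) ^ (l + j) *
      (Nat.choose (a + k - 1) (l - 1) : ℚ) *
      (Nat.choose (a + j - l - 1) (j - l) : ℚ) *
      ∏ t ∈ Finset.Icc 1 k \ {i}, (((l : ℚ) - b - t) / ((i : ℚ) - t))

open Finset in
theorem sum_neg_one_pow_mul_choose_mul_ite (a m j : ℕ) :
    ∑ l ∈ Icc 1 (j + 1), (-1 : ℚ) ^ (l + (j + 1)) *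
      ((a + (j + 1) - l - 1).choose (j + 1 - l) : ℚ) *
        (if m ≤ l - 1 then (a.choose (l - 1 - m) : ℚ) else 0) = if m = j then 1 else 0 := by
  rw [← Ico_add_one_right_eq_Icc, sum_Ico_eq_sum_range, Nat.add_sub_cancel]
  rcases lt_or_ge j m with h | h
  · rw [if_neg (by omega)]
    refine sum_eq_zero fun l hl => ?_
    rw [mem_range] at hl
    rw [if_neg (by omega), mul_zero]
  · obtain ⟨n, rfl⟩ := Nat.exists_eq_add_of_le h
    rw [add_assoc, sum_range_add, sum_eq_zero fun l hl => ?_, zero_add]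
    · have := sum_antidiagonal_choose_mul_neg_choose a n
      rw [Nat.sum_antidiagonal_eq_sum_range_succ_mk] at this
      rw [show (if m = m + n then (1 : ℚ) else 0) = if n = 0 then 1 else 0 by simp, ← this]
      refine sum_congr rfl fun l hl => ?_
      rw [mem_range] at hl
      obtain ⟨e, rfl⟩ := Nat.exists_eq_add_of_le (Nat.le_of_lt_succ hl)
      dsimp only
      rw [if_pos (by omega), show 1 + (m + l) - 1 - m = l by omega,
        show a + (m + (l + e + 1)) - (1 + (m + l)) - 1 = a + e - 1 by omega,
        show m + (l + e + 1) - (1 + (m + l)) = e by omega, Nat.add_sub_cancel_left,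
        show 1 + (m + l) + (m + (l + e + 1)) = 2 * (1 + m + l) + e by ring, pow_add, pow_mul]
      norm_num
      ring
    · rw [mem_range] at hl
      rw [if_neg (by omega), mul_zero]

open Finset Polynomial in
theorem sum_choose_mul_binomialToeplitzInv {a b k m j : ℕ} (hb : b ≤ a) (hm : m < k) (hj : j < k) :
    ∑ i ∈ Icc 1 k, (if m ≤ b + i - 1 then (a.choose (b + i - 1 - m) : ℚ) else 0) *
      binomialToeplitzInv a b k i (j + 1) = if m = j then 1 else 0 := by
  obtain ⟨f, hf, hfc⟩ := exists_polynomial_choose_ratio a hm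
  have hg : (f.comp (X + C ((b : ℚ) - 1))).degree < k := by
    rwa [← taylor_apply, degree_taylor]
  calc
    _ = ∑ i ∈ Icc 1 k, ∑ l ∈ Icc 1 (j + 1), ((-1 : ℚ) ^ (l + (j + 1)) *
          ((a + k - 1).choose (l - 1) : ℚ) * ((a + (j + 1) - l - 1).choose (j + 1 - l) : ℚ)) *
          ((f.comp (X + C ((b : ℚ) - 1))).eval (i : ℚ) *
            ∏ t ∈ Icc 1 k \ {i}, (((l : ℚ) - b - t) / ((i : ℚ) - t))) := by
      refine sum_congr rfl fun i hi => ?_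
      rw [mem_Icc] at hi
      have hc : b + i - 1 ≤ a + k - 1 := by omega
      have h0 : ((a + k - 1).choose (b + i - 1) : ℚ) ≠ 0 :=
        Nat.cast_ne_zero.2 (Nat.choose_pos hc).ne'
      have hx : (f.comp (X + C ((b : ℚ) - 1))).eval (i : ℚ) = f.eval ((b + i - 1 : ℕ) : ℚ) := by
        rw [eval_comp, eval_add, eval_X, eval_C, Nat.cast_sub (by omega)]
        push_cast
        ring_nf
      rw [← hfc _ hc, hx, binomialToeplitzInv, mul_sum, mul_sum]
      refine sum_congr rfl fun l _ => ?_
      field_simp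
    _ = ∑ l ∈ Icc 1 (j + 1), (-1 : ℚ) ^ (l + (j + 1)) *
          ((a + (j + 1) - l - 1).choose (j + 1 - l) : ℚ) *
          (if m ≤ l - 1 then (a.choose (l - 1 - m) : ℚ) else 0) := by
      rw [sum_comm]
      refine sum_congr rfl fun l hl => ?_
      rw [mem_Icc] at hl
      have hx : (f.comp (X + C ((b : ℚ) - 1))).eval ((l : ℚ) - b) = f.eval ((l - 1 : ℕ) : ℚ) := by
        rw [eval_comp, eval_add, eval_X, eval_C, Nat.cast_sub (by omega)]
        push_cast
        ring_nf
      rw [← mul_sum, sum_eval_mul_lagrange hg, hx, ← hfc (l - 1) (by omega)]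
      ring
    _ = _ := sum_neg_one_pow_mul_choose_mul_ite a m j

theorem binomialToeplitz_mul_inv {a b : ℕ} (k : ℕ) (hb : b ≤ a) :
    (binomialToeplitz a b k).map (Int.cast : ℤ → ℚ) *
      Matrix.of (fun i j : Fin k => binomialToeplitzInv a b k (i + 1) (j + 1)) = 1 := by
  ext m j
  have hsum := sum_choose_mul_binomialToeplitzInv hb m.2 j.2
  rw [← Finset.Ico_add_one_right_eq_Icc, Finset.sum_Ico_eq_sum_range, Nat.add_sub_cancel,
    ← Fin.sum_univ_eq_sum_range (fun i : ℕ => (if (m : ℕ) ≤ b + (1 + i) - 1 then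
      (a.choose (b + (1 + i) - 1 - m) : ℚ) else 0) *
        binomialToeplitzInv a b k (1 + i) (j + 1))] at hsum
  simp only [Fin.val_inj] at hsum
  rw [Matrix.mul_apply, Matrix.one_apply, ← hsum]
  refine Finset.sum_congr rfl fun i _ => ?_
  simp [binomialToeplitz, add_comm 1, apply_ite (Int.cast : ℤ → ℚ)]

open Finset in
theorem binomialToeplitzInv_one_one (a b k : ℕ) :
    binomialToeplitzInv a b (k + 1) 1 1 = ((b + k).choose b : ℚ) / (a + k).choose b := by
  have h : ∀ n : ℕ, ∏ t ∈ Icc 1 (n + 1) \ {1}, ((((1 : ℕ) : ℚ) - b - t) / (((1 : ℕ) : ℚ) - t)) =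
      (b + n).choose b := by
    intro n
    rw [sdiff_singleton_eq_erase, Icc_erase_left, ← Ico_add_one_add_one_eq_Ioc,
      prod_Ico_eq_prod_range]
    rw [show n + 1 + 1 - (1 + 1) = n by omega]
    induction n with
    | zero => simp
    | succ n ih =>
      rw [prod_range_succ, ih, ← add_assoc]
      have h1 := congrArg (Nat.cast : ℕ → ℚ) (Nat.choose_mul_succ_eq (b + n) b)
      rw [show b + n + 1 - b = n + 1 by omega] at h1
      simp only [Nat.cast_mul, Nat.cast_add, Nat.cast_one] at h1 ⊢
      have h2 : (1 : ℚ) - (1 + 1 + n) ≠ 0 := by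
        rw [show (1 : ℚ) - (1 + 1 + n) = -(n + 1) by ring]
        exact neg_ne_zero.2 (by positivity)
      rw [← mul_div_assoc, div_eq_iff h2]
      linear_combination -h1
  rw [binomialToeplitzInv, Icc_self, sum_singleton, h k, ← add_assoc, Nat.add_sub_cancel]
  simp [div_eq_mul_inv, mul_comm]

theorem adjugate_binomialToeplitz {a b : ℕ} (k : ℕ) (hb : b ≤ a) (i j : Fin k) :
    ((binomialToeplitz a b k).adjugate i j : ℚ) =
      (binomialToeplitz a b k).det * binomialToeplitzInv a b k (i + 1) (j + 1) := by
  have h := congrArg (fun N => (((binomialToeplitz a b k).map (Int.cast : ℤ → ℚ)).adjugate * N) i j)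
    (binomialToeplitz_mul_inv k hb)
  rw [← Matrix.mul_assoc, Matrix.adjugate_mul, Matrix.smul_mul, Matrix.one_mul, Matrix.mul_one] at h
  rw [Int.cast_det]
  exact (congrFun₂ ((Int.castRingHom ℚ).map_adjugate (binomialToeplitz a b k)) i j).trans h.symm

theorem det_binomialToeplitz {a b : ℕ} (k : ℕ) (hb : b ≤ a) :
    ((binomialToeplitz a b k).det : ℚ) =
      ∏ i ∈ Finset.range k, ((a + i).choose b : ℚ) / ((b + i).choose b : ℚ) := by
  induction k with
  | zero => simp
  | succ k ih =>
    have hsub : (binomialToeplitz a b (k + 1)).submatrix (Fin.succAbove 0) (Fin.succAbove 0) =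
        binomialToeplitz a b k := by
      ext i j
      simp [binomialToeplitz, ← add_assoc]
    have h := adjugate_binomialToeplitz (k + 1) hb 0 0
    rw [Matrix.adjugate_fin_succ_eq_det_submatrix, hsub, Fin.val_zero, zero_add,
      binomialToeplitzInv_one_one, pow_zero, one_mul, ih] at h
    have h1 : ((b + k).choose b : ℚ) ≠ 0 := Nat.cast_ne_zero.2 (Nat.choose_pos (by omega)).ne'
    have h2 : ((a + k).choose b : ℚ) ≠ 0 := Nat.cast_ne_zero.2 (Nat.choose_pos (by omega)).ne'
    rw [Finset.prod_range_succ, h]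
    field_simp

/-- Nordenstam–Young formula for the inverse of a matrix with
binomial entries, reduced mod `p`. -/
theorem stmt5 (p : ℕ) (hp : p.Prime) (F : Type*) [Field F] [CharP F p]
    (a b k : ℕ) (hk : 0 < k)
    (Q : Matrix (Fin k) (Fin k) F)
    (hQdef : ∀ i j : Fin k, Q i j = binF F (a : ℤ) ((b : ℤ) + (j : ℤ) - (i : ℤ)))
    (hQ : IsUnit Q)
    (d : ℚ) (hd : d = ∏ i ∈ Finset.range k,
      (Nat.choose (a + i) b : ℚ) / (Nat.choose (b + i) b : ℚ))
    (z : ℕ → ℕ → ℚ)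
    (hz : ∀ i j : ℕ, z i j =
      (d / (Nat.choose (a + k - 1) (b + i - 1) : ℚ)) *
        ∑ l ∈ Finset.Icc 1 j, (-1 : ℚ) ^ (l + j) *
          (Nat.choose (a + k - 1) (l - 1) : ℚ) *
          (Nat.choose (a + j - l - 1) (j - l) : ℚ) *
          ∏ t ∈ Finset.Icc 1 k \ {i}, (((l : ℚ) - b - t) / ((i : ℚ) - t))) :
    ∃ (D : ℤ) (Z : ℕ → ℕ → ℤ),
      (D : ℚ) = d ∧
      (∀ i j, 1 ≤ i → i ≤ k → 1 ≤ j → j ≤ k → (Z i j : ℚ) = z i j) ∧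
      Q.det = (D : F) ∧ (D : F) ≠ 0 ∧
      Q⁻¹ = Matrix.of fun i j : Fin k =>
        ((D : F))⁻¹ * (Z ((i : ℕ) + 1) ((j : ℕ) + 1) : F) := by
  have hmap : Q = (Int.castRingHom F).mapMatrix (binomialToeplitz a b k) := by
    ext i j
    rw [hQdef, binF]
    simp only [RingHom.mapMatrix_apply, Matrix.map_apply, binomialToeplitz, Matrix.of_apply]
    by_cases h : (i : ℕ) ≤ b + j
    · have hc : (b : ℤ) + (j : ℤ) - (i : ℤ) = ((b + j - i : ℕ) : ℤ) := by omega
      rw [hc, if_pos h]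
      split_ifs with h'
      · simp
      · rw [Nat.choose_eq_zero_of_lt (by omega)]
        simp
    · rw [if_neg h, if_neg (by omega), map_zero]
  have hdet0 : Q.det ≠ 0 := ((Matrix.isUnit_iff_isUnit_det Q).1 hQ).ne_zero
  have hb : b ≤ a := by
    by_contra hab
    refine hdet0 (Matrix.det_eq_zero_of_column_eq_zero ⟨k - 1, by omega⟩ fun i => ?_)
    rw [hQdef, binF, if_neg]
    have := i.2
    simp only
    omega
  have hdet : Q.det = ((binomialToeplitz a b k).det : F) := by
    rw [hmap, ← RingHom.map_det, eq_intCast]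
  have hd' : ((binomialToeplitz a b k).det : ℚ) = d := (det_binomialToeplitz k hb).trans hd.symm
  refine ⟨(binomialToeplitz a b k).det, fun i j =>
    if h : i - 1 < k ∧ j - 1 < k then
      (binomialToeplitz a b k).adjugate ⟨i - 1, h.1⟩ ⟨j - 1, h.2⟩ else 0,
    hd', fun i j hi hik hj hjk => ?_, hdet, hdet ▸ hdet0, ?_⟩
  · have h : i - 1 < k ∧ j - 1 < k := by omega
    simp only [dif_pos h]
    rw [adjugate_binomialToeplitz k hb, hd', hz, binomialToeplitzInv]
    simp only [Nat.sub_add_cancel hi, Nat.sub_add_cancel hj]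
    ring
  · ext i j
    rw [Matrix.inv_def, Ring.inverse_eq_inv', hdet, hmap, ← RingHom.map_adjugate]
    simp
end
end

section
/- For all positive integers r, s and every l with 1 <= l <= min(r,s), writing l_0 = min{ i : lambda_i(r,s) = lambda_l(r,s) } and l_inf = max{ i : lambda_i(r,s) = lambda_l(r,s) }, one has lambda_l(r,s) = r + s - l_0 - l_inf + 1. -/
open scoped BigOperators

noncomputable section

section JordanTensor

open Polynomial

variable {F : Type*} [Field F]

/-- A polynomial in two variables over `F` is homogeneous of degree `d`.  The degree is an
integer, so that the zero polynomial is the only one of negative degree. -/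
def IsHomog (d : ℤ) (h : F[X][X]) : Prop :=
  ∀ i j, (h.coeff i).coeff j ≠ 0 → (i : ℤ) + j = d

namespace IsHomog

lemma add {d : ℤ} {f g : F[X][X]} (hf : IsHomog d f) (hg : IsHomog d g) :
    IsHomog d (f + g) := by
  intro i j h
  by_cases h1 : (f.coeff i).coeff j = 0
  · apply hg i j
    simpa [h1] using h
  · exact hf i j h1

lemma C_mul_X_pow_mul {d : ℤ} {f : F[X][X]} (hf : IsHomog d f) (a : F) (k : ℕ) :
    IsHomog (d + k) (C (C a * X ^ k) * f) := by
  intro i j h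
  rw [coeff_C_mul, mul_assoc, coeff_C_mul, coeff_X_pow_mul'] at h
  split_ifs at h with hk
  · have := hf i (j - k) (right_ne_zero_of_mul h)
    omega
  · simp at h

lemma X_mul {d : ℤ} {f : F[X][X]} (hf : IsHomog d f) : IsHomog (d + 1) (X * f) := by
  intro i j h
  cases i with
  | zero => simp at h
  | succ i =>
    rw [coeff_X_mul] at h
    have := hf i j h
    push_cast
    omega

lemma of_X_mul {d : ℤ} {f : F[X][X]} (hf : IsHomog d (X * f)) : IsHomog (d - 1) f := by
  intro i j h
  have := hf (i + 1) j (by rwa [coeff_X_mul])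
  push_cast at this
  omega

lemma one : IsHomog 0 (1 : F[X][X]) := by
  intro i j h
  rw [coeff_one] at h
  split_ifs at h with hi
  · rw [coeff_one] at h
    split_ifs at h with hj
    · simp [hi, hj]
    · simp at h
  · simp at h

lemma C_X_pow (n : ℕ) : IsHomog (n : ℤ) (C (X ^ n) : F[X][X]) := by
  simpa using one.C_mul_X_pow_mul (1 : F) n

lemma X_sub_C_X_pow (n : ℕ) : IsHomog (n : ℤ) ((X - C X) ^ n : F[X][X]) := by
  induction n with
  | zero => simpa using one
  | succ n ih =>
    have h := ih.X_mul.add (ih.C_mul_X_pow_mul (-1) 1)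
    have e : (X - C X : F[X][X]) ^ (n + 1) =
        X * (X - C X) ^ n + C (C (-1) * X ^ 1) * (X - C X) ^ n := by
      simp only [C_neg, C_1, pow_one, neg_mul, one_mul]
      ring
    rw [e]
    exact_mod_cast h

lemma coeff_zero_eq {n : ℕ} {f : F[X][X]} (hf : IsHomog (n : ℤ) f) :
    f.coeff 0 = C ((f.coeff 0).coeff n) * X ^ n := by
  ext j
  rw [coeff_C_mul_X_pow]
  split_ifs with h
  · rw [h]
  · by_contra h1
    have := hf 0 j h1
    omega

end IsHomog

lemma exists_X_mul_eq {f : F[X][X]} (hf : f.coeff 0 = 0) : ∃ h, f = X * h :=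
  X_dvd_iff.mpr hf

/-- Replace the generator of larger degree by a multiple of `X`. -/
lemma exists_reduced_pair_of_le {u v : ℕ} (huv : u ≤ v) {p q : F[X][X]}
    (hp : IsHomog (u : ℤ) p) (hp0 : (p.coeff 0).coeff u ≠ 0) (hq : IsHomog (v : ℤ) q) :
    ∃ h, IsHomog ((v : ℤ) - 1) h ∧
      Ideal.span {p, X * h} = Ideal.span ({p, q} : Set F[X][X]) := by
  set a : F := -(q.coeff 0).coeff v / (p.coeff 0).coeff u with ha
  have hhom : IsHomog (v : ℤ) (q + C (C a * X ^ (v - u)) * p) := by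
    refine hq.add ?_
    have := hp.C_mul_X_pow_mul a (v - u)
    rwa [show (u : ℤ) + ((v - u : ℕ) : ℤ) = v by omega] at this
  have h0 : (q + C (C a * X ^ (v - u)) * p).coeff 0 = 0 := by
    rw [hhom.coeff_zero_eq]
    have : ((q + C (C a * X ^ (v - u)) * p).coeff 0).coeff v = 0 := by
      rw [coeff_add, coeff_add, coeff_C_mul, mul_assoc, coeff_C_mul, coeff_X_pow_mul',
        if_pos (Nat.sub_le v u), Nat.sub_sub_self huv, ha, div_mul_cancel₀ _ hp0,
        add_neg_cancel]
    rw [this, C_0, zero_mul]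
  obtain ⟨h, hh⟩ := exists_X_mul_eq h0
  refine ⟨h, (hh ▸ hhom).of_X_mul, ?_⟩
  rw [← hh, Ideal.span_pair_add_mul_left]

/-- Two homogeneous generators can be replaced by one that is nonzero modulo `X` and a multiple
of `X`, keeping the degrees. -/
lemma exists_reduced_pair {u : ℕ} {v : ℤ} {p q : F[X][X]}
    (hp : IsHomog (u : ℤ) p) (hp0 : (p.coeff 0).coeff u ≠ 0) (hq : IsHomog v q) :
    ∃ (u' : ℕ) (p' h : F[X][X]), IsHomog (u' : ℤ) p' ∧ (p'.coeff 0).coeff u' ≠ 0 ∧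
      IsHomog (u + v - u' - 1) h ∧ (u' = u ∨ (u' : ℤ) = v) ∧
      Ideal.span {p', X * h} = Ideal.span ({p, q} : Set F[X][X]) := by
  by_cases hq0 : q.coeff 0 = 0
  · obtain ⟨h, rfl⟩ := exists_X_mul_eq hq0
    refine ⟨u, p, h, hp, hp0, ?_, Or.inl rfl, rfl⟩
    rw [show (u : ℤ) + v - u - 1 = v - 1 by ring]
    exact hq.of_X_mul
  · obtain ⟨n, hn⟩ : ∃ n, (q.coeff 0).coeff n ≠ 0 := by
      by_contra! hall
      exact hq0 (Polynomial.ext (by simpa using hall))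
    obtain rfl : (n : ℤ) = v := by
      have := hq 0 n hn
      push_cast at this
      omega
    rcases le_total u n with hun | hun
    · obtain ⟨h, hh, hs⟩ := exists_reduced_pair_of_le hun hp hp0 hq
      refine ⟨u, p, h, hp, hp0, ?_, Or.inl rfl, hs⟩
      rwa [show (u : ℤ) + n - u - 1 = n - 1 by ring]
    · obtain ⟨h, hh, hs⟩ := exists_reduced_pair_of_le hun hq hn hp
      refine ⟨n, q, h, hq, hn, ?_, Or.inr rfl, ?_⟩
      · rwa [show (u : ℤ) + n - n - 1 = u - 1 by ring]
      · rw [hs, Set.pair_comm]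

lemma X_mul_mem_span_pair_iff {p h f : F[X][X]} (hp : p.coeff 0 ≠ 0) :
    X * f ∈ Ideal.span ({p, X * h} : Set F[X][X]) ↔ f ∈ Ideal.span ({p, h} : Set F[X][X]) := by
  simp only [Ideal.mem_span_pair]
  constructor
  · rintro ⟨a, b, hab⟩
    have h0 := congrArg (fun g => g.coeff 0) hab
    simp only [coeff_add, mul_coeff_zero, coeff_X_zero, zero_mul, mul_zero, add_zero,
      mul_eq_zero, hp, or_false] at h0
    obtain ⟨c, rfl⟩ := exists_X_mul_eq h0
    refine ⟨c, b, mul_left_cancel₀ (X_ne_zero (R := F[X])) ?_⟩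
    rw [← hab]
    ring
  · rintro ⟨a, b, rfl⟩
    exact ⟨X * a, b, by ring⟩

lemma mem_span_C_X_pow_X_pow_iff {r s : ℕ} {g : F[X][X]} :
    g ∈ Ideal.span ({C (X ^ r), X ^ s} : Set F[X][X]) ↔
      ∀ j < s, ∀ i < r, (g.coeff j).coeff i = 0 := by
  constructor
  · rw [Ideal.mem_span_pair]
    rintro ⟨a, b, rfl⟩ j hj i hi
    rw [coeff_add, coeff_mul_C, coeff_mul_X_pow', if_neg (by omega), add_zero,
      coeff_mul_X_pow', if_neg (by omega)]
  · intro h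
    rw [g.as_sum_support_C_mul_X_pow]
    refine Ideal.sum_mem _ fun n _ => ?_
    by_cases hn : n < s
    · obtain ⟨c, hc⟩ := X_pow_dvd_iff.mpr (h n hn)
      rw [hc, C_mul, mul_assoc]
      exact Ideal.mul_mem_right _ _ (Ideal.subset_span (by simp))
    · obtain ⟨k, rfl⟩ := Nat.exists_eq_add_of_le (not_lt.mp hn)
      rw [pow_add, mul_left_comm]
      exact Ideal.mul_mem_right _ _ (Ideal.subset_span (by simp))

lemma taylor_X_mem_span_iff {r s : ℕ} {f : F[X][X]} :
    taylor X f ∈ Ideal.span ({C (X ^ r), X ^ s} : Set F[X][X]) ↔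
      f ∈ Ideal.span ({C (X ^ r), (X - C X) ^ s} : Set F[X][X]) := by
  simp only [Ideal.mem_span_pair]
  constructor
  · rintro ⟨a, b, hab⟩
    refine ⟨taylor (-X) a, taylor (-X) b, ?_⟩
    have := congrArg (taylor (-X)) hab
    rw [taylor_taylor, neg_add_cancel, taylor_zero, map_add, taylor_mul, taylor_mul, taylor_C,
      taylor_pow, taylor_X, C_neg, ← sub_eq_add_neg] at this
    exact this
  · rintro ⟨a, b, rfl⟩
    refine ⟨taylor X a, taylor X b, ?_⟩
    rw [map_add, taylor_mul, taylor_mul, taylor_C, taylor_pow, map_sub, taylor_X, taylor_C,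
      add_sub_cancel_right]

variable (F) in
/-- The presentation of `M(r,s)` as a quotient of a polynomial ring on which `T` is
multiplication by the outer variable. -/
def presentation (r s : ℕ) : F[X][X] →ₗ[F] Matrix (Fin r) (Fin s) F where
  toFun f := Matrix.of fun i j => ((taylor X f).coeff (s - 1 - j)).coeff (r - 1 - i)
  map_add' f g := by
    ext i j
    simp
  map_smul' c f := by
    ext i j
    have : taylor X (c • f) = c • taylor X f := by
      rw [← algebraMap_smul F[X] c f, map_smul, algebraMap_smul]
    simp [this]

lemma presentation_apply (r s : ℕ) (f : F[X][X]) (i : Fin r) (j : Fin s) :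
    presentation F r s f i j = ((taylor X f).coeff (s - 1 - j)).coeff (r - 1 - i) := rfl

lemma presentation_eq_zero_iff {r s : ℕ} {f : F[X][X]} :
    presentation F r s f = 0 ↔
      f ∈ Ideal.span ({C (X ^ r), (X - C X) ^ s} : Set F[X][X]) := by
  rw [← taylor_X_mem_span_iff, mem_span_C_X_pow_X_pow_iff]
  constructor
  · intro h j hj i hi
    have := congrFun (congrFun h ⟨r - 1 - i, by omega⟩) ⟨s - 1 - j, by omega⟩
    rw [presentation_apply] at this
    simp only at this
    rwa [show s - 1 - (s - 1 - j) = j by omega, show r - 1 - (r - 1 - i) = i by omega] at this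
  · intro h
    ext i j
    exact h _ (by omega) _ (by omega)

lemma presentation_surjective (r s : ℕ) : Function.Surjective (presentation F r s) := by
  intro A
  refine ⟨taylor (-X) (∑ i : Fin r, ∑ j : Fin s,
    monomial (s - 1 - (j : ℕ)) (monomial (r - 1 - (i : ℕ)) (A i j))), ?_⟩
  ext i j
  rw [presentation_apply, taylor_taylor, add_neg_cancel, taylor_zero]
  simp only [finsetSum_coeff, coeff_monomial]
  rw [Finset.sum_eq_single i, Finset.sum_eq_single j]
  · simp
  · intro b _ hb
    rw [if_neg (fun h => hb (Fin.ext (by omega))), coeff_zero]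
  · simp
  · intro b _ hb
    refine Finset.sum_eq_zero fun c _ => ?_
    split_ifs
    · rw [coeff_monomial, if_neg (fun h => hb (Fin.ext (by omega)))]
    · simp
  · simp

lemma presentation_X_mul (r s : ℕ) (f : F[X][X]) :
    presentation F r s (X * f) = TT F r s (presentation F r s f) := by
  ext i j
  have hR : TT F r s (presentation F r s f) i j =
      (if h : (i : ℕ) + 1 < r then presentation F r s f ⟨(i : ℕ) + 1, h⟩ j else 0) +
      (if h : (j : ℕ) + 1 < s then presentation F r s f i ⟨(j : ℕ) + 1, h⟩ else 0) := rfl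
  rw [hR, presentation_apply, taylor_mul, taylor_X, add_mul, coeff_add, coeff_C_mul, coeff_add,
    add_comm]
  congr 1
  · split_ifs with h
    · rw [presentation_apply, show r - 1 - (i : ℕ) = r - 1 - (i + 1) + 1 by omega, coeff_X_mul]
    · rw [show r - 1 - (i : ℕ) = 0 by omega, coeff_X_mul_zero]
  · split_ifs with h
    · rw [presentation_apply, show s - 1 - (j : ℕ) = s - 1 - (j + 1) + 1 by omega, coeff_X_mul]
    · rw [show s - 1 - (j : ℕ) = 0 by omega, coeff_X_mul_zero, coeff_zero]

lemma presentation_X_pow_mul (r s m : ℕ) (f : F[X][X]) :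
    presentation F r s (X ^ m * f) = (TT F r s ^ m) (presentation F r s f) := by
  induction m with
  | zero => simp
  | succ m ih =>
    rw [pow_succ', mul_assoc, presentation_X_mul, ih, pow_succ', Module.End.mul_apply]

lemma finrank_range_eq_add {V R : Type*} [AddCommGroup V] [Module F V] [FiniteDimensional F V]
    [AddCommGroup R] [Module F R] (g : R →ₗ[F] V) (W : Submodule F V)
    (hW : W ≤ LinearMap.range g) {n : ℕ} (c : R →ₗ[F] (Fin n → F)) (hc : Function.Surjective c)
    (h : ∀ f, g f ∈ W ↔ c f = 0) :
    Module.finrank F (LinearMap.range g) = Module.finrank F W + n := by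
  have hker : LinearMap.ker (W.mkQ ∘ₗ g) = LinearMap.ker c := by
    ext f
    simp [h]
  have e1 : Module.finrank F (LinearMap.range (W.mkQ ∘ₗ g)) = n := by
    rw [← (W.mkQ ∘ₗ g).quotKerEquivRange.finrank_eq, hker, c.quotKerEquivRange.finrank_eq,
      LinearMap.range_eq_top.mpr hc, finrank_top, Module.finrank_fin_fun]
  have e2 := LinearMap.finrank_range_add_finrank_ker (W.mkQ.domRestrict (LinearMap.range g))
  rw [LinearMap.range_domRestrict, ← LinearMap.range_comp, e1, LinearMap.ker_domRestrict,
    Submodule.ker_mkQ, (Submodule.comapSubtypeEquivOfLe hW).finrank_eq] at e2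
  omega

/-- The annihilator of `T ^ m` is generated by two homogeneous elements, of degrees `u` and
`r + s - m - u`, the first nonzero modulo `X` and the second a multiple of `X`. -/
def HasReducedGenerators (F : Type*) [Field F] (r s m u : ℕ) : Prop :=
  ∃ p h : F[X][X], IsHomog (u : ℤ) p ∧ (p.coeff 0).coeff u ≠ 0 ∧
    IsHomog ((r : ℤ) + s - m - u - 1) h ∧
    ∀ f, presentation F r s (X ^ m * f) = 0 ↔
      f ∈ Ideal.span ({p, X * h} : Set F[X][X])

lemma exists_hasReducedGenerators_zero (r s : ℕ) : ∃ u, HasReducedGenerators F r s 0 u := by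
  obtain ⟨u, p, h, hp, hp0, hh, -, hs⟩ := exists_reduced_pair (IsHomog.C_X_pow (F := F) r)
    (by rw [coeff_C_zero, coeff_X_pow_self]; exact one_ne_zero) (IsHomog.X_sub_C_X_pow s)
  refine ⟨u, p, h, hp, hp0, by simpa using hh, fun f => ?_⟩
  rw [pow_zero, one_mul, presentation_eq_zero_iff, hs]

namespace HasReducedGenerators

lemma succ {r s m u : ℕ} (H : HasReducedGenerators F r s m u) :
    ∃ u', HasReducedGenerators F r s (m + 1) u' ∧
      (u' = u ∨ (u' : ℤ) = (r : ℤ) + s - m - u - 1) := by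
  obtain ⟨p, h, hp, hp0, hh, hJ⟩ := H
  obtain ⟨u', p', h', hp', hp0', hh', hu', hs⟩ := exists_reduced_pair hp hp0 hh
  refine ⟨u', ⟨p', h', hp', hp0', ?_, fun f => ?_⟩, hu'⟩
  · convert hh' using 1
    push_cast
    ring
  · rw [hs, pow_succ, mul_assoc, hJ, X_mul_mem_span_pair_iff]
    intro h0
    simp [h0] at hp0

lemma presentation_mem_range_iff {r s m u : ℕ} (H : HasReducedGenerators F r s m u)
    (f : F[X][X]) : presentation F r s (X ^ m * f) ∈ LinearMap.range (TT F r s ^ (m + 1)) ↔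
      X ^ u ∣ f.coeff 0 := by
  obtain ⟨p, h, hp, hp0, hh, hJ⟩ := H
  have hpc := hp.coeff_zero_eq
  constructor
  · rintro ⟨A, hA⟩
    obtain ⟨g, rfl⟩ := presentation_surjective r s A
    have h0 : presentation F r s (X ^ m * (f - X * g)) = 0 := by
      rw [mul_sub, map_sub, ← mul_assoc, ← pow_succ, presentation_X_pow_mul r s (m + 1), hA,
        sub_self]
    obtain ⟨a, b, hab⟩ := Ideal.mem_span_pair.mp ((hJ _).mp h0)
    have h1 := congrArg (fun g => g.coeff 0) hab
    simp only [coeff_add, coeff_sub, mul_coeff_zero, coeff_X_zero, zero_mul, mul_zero, add_zero,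
      sub_zero] at h1
    rw [← h1, hpc]
    exact Dvd.intro_left (a.coeff 0 * C ((p.coeff 0).coeff u)) (by ring)
  · rintro ⟨c, hc⟩
    have h0 : (f - C (C ((p.coeff 0).coeff u)⁻¹ * c) * p).coeff 0 = 0 := by
      rw [coeff_sub, coeff_C_mul, hc]
      nth_rw 2 [hpc]
      have : (C ((p.coeff 0).coeff u)⁻¹ * C ((p.coeff 0).coeff u) : F[X]) = 1 := by
        rw [← C_mul, inv_mul_cancel₀ hp0, C_1]
      linear_combination (-(c * X ^ u)) * this
    obtain ⟨g, hg⟩ := exists_X_mul_eq h0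
    refine ⟨presentation F r s g, ?_⟩
    rw [← presentation_X_pow_mul, pow_succ, mul_assoc, ← hg, mul_sub, map_sub, sub_eq_self, hJ]
    exact Ideal.mul_mem_left _ _ (Ideal.subset_span (by simp))

lemma finrank_range {r s m u : ℕ} (H : HasReducedGenerators F r s m u) :
    Module.finrank F (LinearMap.range (TT F r s ^ m)) =
      Module.finrank F (LinearMap.range (TT F r s ^ (m + 1))) + u := by
  let g : F[X][X] →ₗ[F] Matrix (Fin r) (Fin s) F := (TT F r s ^ m) ∘ₗ presentation F r s
  have hg : LinearMap.range g = LinearMap.range (TT F r s ^ m) :=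
    LinearMap.range_comp_of_range_eq_top _
      (LinearMap.range_eq_top.mpr (presentation_surjective r s))
  let c : F[X][X] →ₗ[F] (Fin u → F) :=
    { toFun := fun f j => (f.coeff 0).coeff j
      map_add' := fun f g => by ext; simp
      map_smul' := fun a f => by ext; simp }
  rw [← hg]
  refine finrank_range_eq_add g _ ?_ c ?_ fun f => ?_
  · rw [hg, pow_succ, Module.End.mul_eq_comp]
    exact LinearMap.range_comp_le_range _ _
  · intro a
    refine ⟨C (∑ i : Fin u, monomial (i : ℕ) (a i)), ?_⟩
    ext j
    simp [c, coeff_monomial, Fin.val_inj]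
  · have : g f = presentation F r s (X ^ m * f) := (presentation_X_pow_mul r s m f).symm
    rw [this, H.presentation_mem_range_iff, X_pow_dvd_iff, funext_iff]
    exact ⟨fun h j => h j j.2, fun h j hj => h ⟨j, hj⟩⟩

end HasReducedGenerators

lemma hasReducedGenerators_finrank_sub (r s m : ℕ) :
    HasReducedGenerators F r s m (Module.finrank F (LinearMap.range (TT F r s ^ m)) -
      Module.finrank F (LinearMap.range (TT F r s ^ (m + 1)))) := by
  have key : ∃ u, HasReducedGenerators F r s m u := by
    induction m with
    | zero => exact exists_hasReducedGenerators_zero r s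
    | succ m ih =>
      obtain ⟨u, hu⟩ := ih
      obtain ⟨u', hu', -⟩ := hu.succ
      exact ⟨u', hu'⟩
  obtain ⟨u, hu⟩ := key
  rwa [hu.finrank_range, Nat.add_sub_cancel_left]

/-- Consecutive rank drops are equal or add up to `r + s - m - 1`. -/
lemma finrank_sub_succ_eq_or (F : Type*) [Field F] (r s m : ℕ) {c c' : ℕ}
    (hc : c = Module.finrank F (LinearMap.range (TT F r s ^ m)) -
      Module.finrank F (LinearMap.range (TT F r s ^ (m + 1))))
    (hc' : c' = Module.finrank F (LinearMap.range (TT F r s ^ (m + 1))) -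
      Module.finrank F (LinearMap.range (TT F r s ^ (m + 2)))) :
    c' = c ∨ (c' : ℤ) = (r : ℤ) + s - m - c - 1 := by
  have H := hasReducedGenerators_finrank_sub (F := F) r s m
  rw [← hc] at H
  obtain ⟨u', hu', h⟩ := H.succ
  rw [hu'.finrank_range, Nat.add_sub_cancel_left] at hc'
  rwa [hc']

end JordanTensor

/-- `lambda_l = r + s - l₀ - l∞ + 1`. -/
theorem stmt9 (p : ℕ) (hp : p.Prime) (F : Type*) [Field F] [CharP F p]
    (r s : ℕ) (hr : 0 < r) (hs : 0 < s)
    (lam : ℕ → ℕ) (hlam : IsJordanType F r s lam)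
    (l l0 linf : ℕ) (hl1 : 1 ≤ l) (hl2 : l ≤ min r s)
    (hl0 : IsLeast {i : ℕ | 1 ≤ i ∧ i ≤ min r s ∧ lam i = lam l} l0)
    (hlinf : IsGreatest {i : ℕ | 1 ≤ i ∧ i ≤ min r s ∧ lam i = lam l} linf) :
    (lam l : ℤ) = (r : ℤ) + s - l0 - linf + 1 := by
  obtain ⟨hpos, hanti, hcard⟩ := hlam
  obtain ⟨⟨h01, h02, h03⟩, hmin⟩ := hl0
  obtain ⟨⟨hi1, hi2, hi3⟩, hmax⟩ := hlinf
  have hll : l0 ≤ linf := hmin ⟨hi1, hi2, hi3⟩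
  have hlpos := hpos l hl1 hl2
  obtain ⟨m, hm⟩ : ∃ m, lam l = m + 1 := ⟨lam l - 1, by omega⟩
  have c1 : ((Finset.Icc 1 (min r s)).filter fun i => m + 1 ≤ lam i) = Finset.Icc 1 linf := by
    ext i
    simp only [Finset.mem_filter, Finset.mem_Icc]
    constructor
    · rintro ⟨⟨h1, h2⟩, h3⟩
      refine ⟨h1, ?_⟩
      by_contra! hlt
      have := hanti linf i hi1 hlt.le h2
      have := hmax ⟨h1, h2, by omega⟩
      omega
    · rintro ⟨h1, h2⟩
      have := hanti i linf h1 h2 hi2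
      exact ⟨⟨h1, h2.trans hi2⟩, by omega⟩
  have c2 : ((Finset.Icc 1 (min r s)).filter fun i => m + 2 ≤ lam i) =
      Finset.Icc 1 (l0 - 1) := by
    ext i
    simp only [Finset.mem_filter, Finset.mem_Icc]
    constructor
    · rintro ⟨⟨h1, h2⟩, h3⟩
      refine ⟨h1, ?_⟩
      by_contra! hlt
      have := hanti l0 i h01 (by omega) h2
      omega
    · rintro ⟨h1, h2⟩
      have := hanti i l0 h1 (by omega) h02
      refine ⟨⟨h1, by omega⟩, ?_⟩
      by_contra! hlt
      have := hmin ⟨h1, by omega, by omega⟩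
      omega
  have e1 := hcard (m + 1) (by omega)
  have e2 := hcard (m + 2) (by omega)
  rw [c1, Nat.card_Icc, Nat.add_sub_cancel, Nat.add_sub_cancel] at e1
  rw [c2, Nat.card_Icc, Nat.add_sub_cancel, show m + 2 - 1 = m + 1 by omega] at e2
  have := finrank_sub_succ_eq_or F r s m e1 e2
  omega
end
end
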